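/- arXiv:1712.09743 — 6 statements merged into one kernel-verified Lean document; each statement's English description precedes it below -/
import Mathlib

section
/- Let z̄ be a feasible point of (MP1) at which the Robinson constraint qualification holds, and let d ∈ C₁(z̄) := {d ∈ Z : ∇f(z̄)d ∈ −ℝ^m₊, ∇G(z̄)d ∈ T(Q; G(z̄))}. If z̄ is a locally weak Pareto solution of (MP1), then the system ∇f_i(z̄)z + ∇²f_i(z̄)(d,d) < 0 for all i ∈ I(z̄, d), together with ∇G(z̄)z + ∇²G(z̄)(d,d) ∈ T^{2♭}(Q; G(z̄), ∇G(z̄)d), has no solution z ∈ Z, where I(z̄, d) := {i ∈ {1,…,m} : ∇f_i(z̄)d = 0}. -/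
open Filter Topology

/-- The contingent (Bouligand) cone to `Ω` at `x`. -/
def contCone {X : Type*} [NormedAddCommGroup X] [NormedSpace ℝ X]
    (Ω : Set X) (x : X) : Set X :=
  {h | ∃ t : ℕ → ℝ, ∃ v : ℕ → X,
    (∀ k, 0 < t k) ∧ Tendsto t atTop (𝓝 0) ∧ Tendsto v atTop (𝓝 h) ∧
    ∀ k, x + t k • v k ∈ Ω}

/-- The second-order adjacent tangent set `T^{2♭}(Ω; x, h)`. -/
def secondAdjacentSet {X : Type*} [NormedAddCommGroup X] [NormedSpace ℝ X]
    (Ω : Set X) (x h : X) : Set X :=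
  {w | ∀ t : ℕ → ℝ, (∀ k, 0 < t k) → Tendsto t atTop (𝓝 0) →
    ∃ v : ℕ → X, Tendsto v atTop (𝓝 w) ∧
      ∀ k, x + t k • h + ((t k) ^ 2 / 2) • v k ∈ Ω}

/-- An approximate zero of `φ` that can be improved repeatedly, at linear cost, inside a closed
subset of a complete metric space leads to an exact zero nearby. -/
theorem exists_zero_of_halving_step {X : Type*} [MetricSpace X] [CompleteSpace X]
    {S : Set X} (hS : IsClosed S) {φ : X → ℝ} (hφ : Continuous φ) (hφ0 : ∀ u, 0 ≤ φ u)
    {C R : ℝ} (hC : 0 ≤ C) {u₀ : X} (hu₀ : u₀ ∈ S) (hR : 2 * C * φ u₀ ≤ R)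
    (step : ∀ u ∈ S, dist u₀ u ≤ R → φ u ≤ φ u₀ →
      ∃ u' ∈ S, dist u u' ≤ C * φ u ∧ φ u' ≤ φ u / 2) :
    ∃ u ∈ S, φ u = 0 ∧ dist u₀ u ≤ 2 * C * φ u₀ := by
  have step' : ∀ u, ∃ u', u ∈ S → dist u₀ u ≤ R → φ u ≤ φ u₀ →
      u' ∈ S ∧ dist u u' ≤ C * φ u ∧ φ u' ≤ φ u / 2 := by
    intro u
    by_cases h : u ∈ S ∧ dist u₀ u ≤ R ∧ φ u ≤ φ u₀
    · obtain ⟨u', h1, h2⟩ := step u h.1 h.2.1 h.2.2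
      exact ⟨u', fun _ _ _ => ⟨h1, h2⟩⟩
    · exact ⟨u, fun h1 h2 h3 => absurd ⟨h1, h2, h3⟩ h⟩
  choose g hg using step'
  let u : ℕ → X := fun n => g^[n] u₀
  have hsucc : ∀ n, u (n + 1) = g (u n) := fun n => Function.iterate_succ_apply' g n u₀
  have hCφ : 0 ≤ C * φ u₀ := mul_nonneg hC (hφ0 u₀)
  have hhalf : ∀ n : ℕ, φ u₀ / 2 ^ n ≤ φ u₀ := fun n =>
    div_le_self (hφ0 u₀) (one_le_pow₀ one_le_two)
  have inv : ∀ n, u n ∈ S ∧ φ (u n) ≤ φ u₀ / 2 ^ n ∧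
      dist u₀ (u n) ≤ 2 * C * φ u₀ * (1 - 1 / 2 ^ n) := by
    intro n
    induction n with
    | zero => simpa [u] using hu₀
    | succ n ih =>
      obtain ⟨h1, h2, h3⟩ := ih
      have hp : (0 : ℝ) < 1 / 2 ^ n := by positivity
      have hle : dist u₀ (u n) ≤ R := by nlinarith
      obtain ⟨k1, k2, k3⟩ := hg (u n) h1 hle (h2.trans (hhalf n))
      rw [hsucc]
      refine ⟨k1, ?_, ?_⟩
      · rw [pow_succ, ← div_div]
        linarith
      · have h4 := dist_triangle u₀ (u n) (g (u n))
        have h5 : C * φ (u n) ≤ C * (φ u₀ / 2 ^ n) := mul_le_mul_of_nonneg_left h2 hC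
        have h6 : 2 * C * φ u₀ * (1 - 1 / 2 ^ (n + 1)) =
            2 * C * φ u₀ * (1 - 1 / 2 ^ n) + C * (φ u₀ / 2 ^ n) := by
          rw [pow_succ]; field_simp; ring
        linarith
  have hdist : ∀ n, dist (u n) (u (n + 1)) ≤ 2 * C * φ u₀ / 2 / 2 ^ n := by
    intro n
    obtain ⟨h1, h2, h3⟩ := inv n
    have hp : (0 : ℝ) < 1 / 2 ^ n := by positivity
    obtain ⟨-, k2, -⟩ := hg (u n) h1 (by nlinarith) (h2.trans (hhalf n))
    rw [hsucc]
    have h5 : C * φ (u n) ≤ C * (φ u₀ / 2 ^ n) := mul_le_mul_of_nonneg_left h2 hC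
    have h6 : 2 * C * φ u₀ / 2 / 2 ^ n = C * (φ u₀ / 2 ^ n) := by ring
    linarith
  obtain ⟨a, ha⟩ := cauchySeq_tendsto_of_complete (cauchySeq_of_le_geometric_two hdist)
  refine ⟨a, hS.mem_of_tendsto ha (Eventually.of_forall fun n => (inv n).1), ?_, ?_⟩
  · have hz : Tendsto (fun n : ℕ => φ u₀ / 2 ^ n) atTop (𝓝 0) :=
      tendsto_const_nhds.div_atTop (tendsto_pow_atTop_atTop_of_one_lt one_lt_two)
    exact tendsto_nhds_unique ((hφ.tendsto a).comp ha)
      (squeeze_zero (fun n => hφ0 _) (fun n => (inv n).2.1) hz)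
  · simpa [u] using dist_le_of_le_geometric_two_of_tendsto₀ hdist ha

/-- Under the Robinson constraint qualification, points that almost satisfy `G x ∈ Q` can be
corrected to feasible points at a linear cost. -/
theorem exists_feasible_near_of_robinson
    {Z E : Type*} [NormedAddCommGroup Z] [NormedSpace ℝ Z] [CompleteSpace Z]
    [NormedAddCommGroup E] [NormedSpace ℝ E] [CompleteSpace E]
    {G : Z → E} {A : Z →L[ℝ] E} {Q : Set E} {zb : Z}
    (hGc : Continuous G) (hG : HasStrictFDerivAt G A zb)
    (hQcl : IsClosed Q) (hQcv : Convex ℝ Q)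
    (hRob : (0 : E) ∈ interior (Set.image2 (fun a b => a - b)
      (A '' Metric.closedBall 0 1)
      (((fun q => q - G zb) '' Q) ∩ Metric.closedBall 0 1))) :
    ∃ C > 0, ∃ ε > 0, ∀ x, ∀ q ∈ Q, ‖x - zb‖ ≤ ε → ‖q - G zb‖ ≤ ε → ‖G x - q‖ ≤ ε →
      ∃ x', G x' ∈ Q ∧ ‖x' - x‖ ≤ C * ‖G x - q‖ := by
  obtain ⟨r, hr, hball⟩ := Metric.nhds_basis_closedBall.mem_iff.1 (mem_interior_iff_mem_nhds.1 hRob)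
  obtain ⟨ρ, hρ, hstrict⟩ := Metric.eventually_nhds_iff_ball.1
    (hG.isLittleO.def (show 0 < r / 4 by positivity))
  have hstrict' : ∀ x y, ‖x - zb‖ < ρ → ‖y - zb‖ < ρ →
      ‖G x - G y - A (x - y)‖ ≤ r / 4 * ‖x - y‖ := by
    intro x y hx hy
    refine hstrict (x, y) ?_
    rw [← ball_prod_same]
    exact ⟨mem_ball_iff_norm.2 hx, mem_ball_iff_norm.2 hy⟩
  have linear_step : ∀ e : E, ∃ a : Z, ∃ p ∈ Q, ‖a‖ ≤ 1 ∧ ‖p - G zb‖ ≤ 1 ∧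
      (‖e‖ / r) • (A a - (p - G zb)) = -e := by
    intro e
    have hmem : -((r / ‖e‖) • e) ∈ Metric.closedBall (0 : E) r := by
      rw [mem_closedBall_zero_iff, norm_neg, norm_smul, norm_div, norm_norm,
        Real.norm_of_nonneg hr.le]
      rcases (norm_nonneg e).eq_or_lt with h | h
      · simp [← h, hr.le]
      · exact (div_mul_cancel₀ r h.ne').le
    obtain ⟨_, ⟨a, ha, rfl⟩, _, ⟨⟨p, hp, rfl⟩, hp1⟩, hap⟩ := hball hmem
    refine ⟨a, p, hp, mem_closedBall_zero_iff.1 ha, mem_closedBall_zero_iff.1 hp1, ?_⟩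
    dsimp only at hap
    rw [hap, smul_neg, smul_smul]
    rcases eq_or_ne e 0 with rfl | he
    · simp
    · have : ‖e‖ ≠ 0 := norm_ne_zero_iff.2 he
      rw [show ‖e‖ / r * (r / ‖e‖) = 1 by field_simp, one_smul]
  set R : ℝ := min (ρ / 4) (min (r / 8) (1 / 8)) with hRdef
  have hR : 0 < R := by positivity
  have hRρ : R ≤ ρ / 4 := min_le_left _ _
  have hRr : R ≤ r / 8 := (min_le_right _ _).trans (min_le_left _ _)
  have hR1 : R ≤ 1 / 8 := (min_le_right _ _).trans (min_le_right _ _)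
  set ε : ℝ := min R (r * R / 4) with hεdef
  have hε : 0 < ε := by positivity
  have hεR : ε ≤ R := min_le_left _ _
  have hεr : ε ≤ r * R / 4 := min_le_right _ _
  refine ⟨2 * (2 / r), by positivity, ε, hε, fun x q hq hx hqb he => ?_⟩
  have key := exists_zero_of_halving_step (X := Z × E) (S := Prod.snd ⁻¹' Q)
    (hQcl.preimage continuous_snd) (φ := fun u => ‖G u.1 - u.2‖) (by fun_prop)
    (fun u => norm_nonneg _) (C := 2 / r) (R := R) (by positivity) (u₀ := (x, q)) hq
    (by
      calc 2 * (2 / r) * ‖G x - q‖ ≤ 2 * (2 / r) * (r * R / 4) := by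
            gcongr; exact he.trans hεr
        _ = R := by field_simp; norm_num)
    (by
      rintro ⟨y, p⟩ hp hdist hφ
      replace hp : p ∈ Q := hp
      rw [Prod.dist_eq, max_le_iff, dist_comm, dist_comm q p, dist_eq_norm, dist_eq_norm] at hdist
      obtain ⟨hyx, hpq⟩ := hdist
      dsimp only at hyx hpq hφ ⊢
      have hy : ‖y - zb‖ ≤ ρ / 2 := by
        linarith [norm_sub_le_norm_sub_add_norm_sub y x zb]
      have hpb : ‖p - G zb‖ ≤ r / 4 := by
        linarith [norm_sub_le_norm_sub_add_norm_sub p q (G zb)]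
      have hpb1 : ‖p - G zb‖ ≤ 1 := by
        linarith [norm_sub_le_norm_sub_add_norm_sub p q (G zb)]
      obtain ⟨a, b, hb, ha1, hb1, hab⟩ := linear_step (G y - p)
      set s : ℝ := ‖G y - p‖ / r with hs
      have hsr : s * r = ‖G y - p‖ := div_mul_cancel₀ _ hr.ne'
      have hs0 : 0 ≤ s := by positivity
      have hsR : s ≤ R / 4 := by
        rw [hs, div_le_iff₀ hr]
        linarith
      have hsa : ‖s • a‖ ≤ s := by
        rw [norm_smul, Real.norm_of_nonneg hs0]
        exact mul_le_of_le_one_right hs0 ha1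
      have hbp : ‖s • (b - p)‖ ≤ 2 * s := by
        rw [norm_smul, Real.norm_of_nonneg hs0]
        have := norm_sub_le_norm_sub_add_norm_sub b (G zb) p
        rw [norm_sub_rev (G zb)] at this
        nlinarith
      have hC : 2 / r * ‖G y - p‖ = 2 * s := by rw [hs]; ring
      refine ⟨(y + s • a, p + s • (b - p)), ?_, ?_, ?_⟩
      · exact hQcv.add_smul_sub_mem hp hb ⟨hs0, by linarith⟩
      · rw [hC, Prod.dist_eq, dist_self_add_right, dist_self_add_right]
        exact max_le (by linarith) hbp
      · have hya : ‖y + s • a - zb‖ < ρ := by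
          have := norm_add_le (y - zb) (s • a)
          rw [show y + s • a - zb = y - zb + s • a by abel]
          linarith
        have hrem := hstrict' (y + s • a) y hya (by linarith)
        rw [add_sub_cancel_left] at hrem
        have hsplit : G (y + s • a) - (p + s • (b - p)) =
            (G (y + s • a) - G y - A (s • a)) + s • (p - G zb) := by
          have : G y = p - s • (A a - (b - G zb)) := by rw [hab]; abel
          rw [this, map_smul]
          module
        have hsp : ‖s • (p - G zb)‖ ≤ s * (r / 4) := by
          rw [norm_smul, Real.norm_of_nonneg hs0]
          gcongr
        have := norm_add_le (G (y + s • a) - G y - A (s • a)) (s • (p - G zb))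
        rw [← hsplit] at this
        nlinarith)
  obtain ⟨⟨x', q'⟩, hq', hzero, hdist⟩ := key
  have hGq : G x' = q' := sub_eq_zero.1 (norm_eq_zero.1 hzero)
  refine ⟨x', hGq ▸ hq', ?_⟩
  rw [← dist_eq_norm, dist_comm]
  exact (le_max_left _ _).trans hdist

/-- Second-order expansion of a curve whose derivative is differentiable at `0`. -/
theorem isLittleO_second_order_of_hasDerivAt {Y : Type*} [NormedAddCommGroup Y] [NormedSpace ℝ Y]
    {g g' : ℝ → Y} {g'' : Y} (hg : ∀ t, HasDerivAt g (g' t) t) (hg' : HasDerivAt g' g'' 0) :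
    (fun t : ℝ => g t - g 0 - t • g' 0 - (t ^ 2 / 2) • g'') =o[𝓝 0] fun t => t ^ 2 := by
  rw [Asymptotics.isLittleO_iff]
  intro c hc
  have h1 := (hasDerivAt_iff_isLittleO.1 hg').def hc
  obtain ⟨ρ, hρ, hb⟩ := Metric.eventually_nhds_iff_ball.1 h1
  filter_upwards [Metric.ball_mem_nhds (0 : ℝ) hρ] with t ht
  have hsub : ∀ s ∈ Set.uIcc 0 t, |s| ≤ |t| := fun s hs => by
    simpa using Set.abs_sub_left_of_mem_uIcc hs
  have hder : ∀ s ∈ Set.uIcc 0 t, HasDerivWithinAt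
      (fun t : ℝ => g t - g 0 - t • g' 0 - (t ^ 2 / 2) • g'')
      (g' s - g' 0 - s • g'') (Set.uIcc 0 t) s := by
    intro s _
    have e1 : HasDerivAt (fun t : ℝ => t ^ 2 / 2) s s := by
      simpa using (hasDerivAt_pow 2 s).div_const 2
    have e := (((hg s).sub_const (g 0)).sub ((hasDerivAt_id s).smul_const (g' 0))).sub
      (e1.smul_const g'')
    rw [one_smul] at e
    exact e.hasDerivWithinAt
  have hbound : ∀ s ∈ Set.uIcc 0 t, ‖g' s - g' 0 - s • g''‖ ≤ c * |t| := by
    intro s hs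
    have hs' : s ∈ Metric.ball (0 : ℝ) ρ := by
      rw [mem_ball_zero_iff, Real.norm_eq_abs] at ht ⊢
      exact (hsub s hs).trans_lt ht
    have := hb s hs'
    simp only [sub_zero, Real.norm_eq_abs] at this
    exact this.trans (mul_le_mul_of_nonneg_left (hsub s hs) hc.le)
  have := (convex_uIcc 0 t).norm_image_sub_le_of_norm_hasDerivWithin_le hder hbound
    Set.left_mem_uIcc Set.right_mem_uIcc
  simpa [pow_two, mul_assoc] using this

/-- Second-order expansion of a `C²` map along a parabolic arc. -/
theorem ContDiff.isLittleO_parabolic_arc {X Y : Type*} [NormedAddCommGroup X] [NormedSpace ℝ X]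
    [NormedAddCommGroup Y] [NormedSpace ℝ Y] {F : X → Y} (hF : ContDiff ℝ 2 F) (x d z : X) :
    (fun t : ℝ => F (x + t • d + (t ^ 2 / 2) • z) - F x - t • fderiv ℝ F x d
      - (t ^ 2 / 2) • (fderiv ℝ F x z + fderiv ℝ (fderiv ℝ F) x d d))
      =o[𝓝 0] fun t => t ^ 2 := by
  let γ : ℝ → X := fun t => x + t • d + (t ^ 2 / 2) • z
  have hγ0 : γ 0 = x := by simp [γ]
  have hγ : ∀ t, HasDerivAt γ (d + t • z) t := by
    intro t
    have e1 : HasDerivAt (fun t : ℝ => t ^ 2 / 2) t t := by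
      simpa using (hasDerivAt_pow 2 t).div_const 2
    have e2 : HasDerivAt (fun t : ℝ => x + t • d) d t := by
      simpa using ((hasDerivAt_id t).smul_const d).const_add x
    exact e2.add (e1.smul_const z)
  have hF1 : Differentiable ℝ F := hF.differentiable (by norm_num)
  have hF2 : Differentiable ℝ (fderiv ℝ F) :=
    (hF.fderiv_right (m := 1) (by norm_num)).differentiable (by norm_num)
  have h1 : ∀ t, HasDerivAt (F ∘ γ) (fderiv ℝ F (γ t) (d + t • z)) t := fun t =>
    (hF1 (γ t)).hasFDerivAt.comp_hasDerivAt t (hγ t)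
  have h2 : HasDerivAt (fun t => fderiv ℝ F (γ t) (d + t • z))
      (fderiv ℝ F x z + fderiv ℝ (fderiv ℝ F) x d d) 0 := by
    have e1 := (hF2 (γ 0)).hasFDerivAt.comp_hasDerivAt 0 (hγ 0)
    have e2 : HasDerivAt (fun t : ℝ => d + t • z) z 0 := by
      simpa using ((hasDerivAt_id (0 : ℝ)).smul_const z).const_add d
    have e := e1.clm_apply e2
    simpa [hγ0, add_comm] using e
  simpa [γ] using isLittleO_second_order_of_hasDerivAt h1 h2

/-- A quadratic with nonpositive linear coefficient, and negative quadratic coefficient when the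
linear one vanishes, is eventually negative along positive null sequences, even after a
second-order perturbation. -/
theorem eventually_neg_of_isLittleO_second_order {t s : ℕ → ℝ} {a b : ℝ}
    (ht : ∀ k, 0 < t k) (ht0 : Tendsto t atTop (𝓝 0)) (ha : a ≤ 0) (hb : a = 0 → b < 0)
    (hs : (fun k => s k - t k * a - t k ^ 2 / 2 * b) =o[atTop] fun k => t k ^ 2) :
    ∀ᶠ k in atTop, s k < 0 := by
  rcases ha.eq_or_lt with rfl | ha
  · filter_upwards [hs.def (show 0 < -b / 4 by linarith [hb rfl])] with k hk
    rw [Real.norm_eq_abs, Real.norm_of_nonneg (by positivity)] at hk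
    have := (abs_le.1 hk).2
    nlinarith [pow_pos (ht k) 2, hb rfl]
  · have hsmall : ∀ᶠ k in atTop, t k * (1 + |b| / 2) < -a := by
      have : Tendsto (fun k => t k * (1 + |b| / 2)) atTop (𝓝 0) := by
        simpa using ht0.mul_const (1 + |b| / 2)
      exact this.eventually (gt_mem_nhds (by linarith))
    filter_upwards [hs.def one_pos, hsmall] with k hk hk'
    rw [Real.norm_eq_abs, Real.norm_of_nonneg (by positivity)] at hk
    have h1 := (abs_le.1 hk).2
    have h2 : t k ^ 2 / 2 * b ≤ t k ^ 2 / 2 * |b| := by gcongr; exact le_abs_self b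
    nlinarith [mul_lt_mul_of_pos_left hk' (ht k)]

/-- If `z̄` is a locally weak Pareto solution of (MP1) satisfying the Robinson constraint
qualification and `d ∈ C₁(z̄)`, then the second-order system
`∇f_i(z̄)z + ∇²f_i(z̄)(d,d) < 0` for `i ∈ I(z̄,d)`,
`∇G(z̄)z + ∇²G(z̄)(d,d) ∈ T^{2♭}(Q; G(z̄), ∇G(z̄)d)` has no solution `z`. -/
theorem secondOrder_system_has_no_solution
    {Z E : Type*} [NormedAddCommGroup Z] [NormedSpace ℝ Z] [CompleteSpace Z]
    [NormedAddCommGroup E] [NormedSpace ℝ E] [CompleteSpace E]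
    {m : ℕ} (f : Fin m → Z → ℝ) (G : Z → E) (Q : Set E)
    (hf : ∀ i, ContDiff ℝ 2 (f i)) (hG : ContDiff ℝ 2 G)
    (hQne : Q.Nonempty) (hQcl : IsClosed Q) (hQcv : Convex ℝ Q)
    (zb : Z) (hfeas : G zb ∈ Q)
    (hRob : (0 : E) ∈ interior (Set.image2 (fun a b => a - b)
      ((fderiv ℝ G zb) '' Metric.closedBall 0 1)
      (((fun q => q - G zb) '' Q) ∩ Metric.closedBall 0 1)))
    (d : Z)
    (hd : (∀ i, fderiv ℝ (f i) zb d ≤ 0) ∧ fderiv ℝ G zb d ∈ contCone Q (G zb))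
    (hPareto : ∃ ε > 0, ∀ z : Z, G z ∈ Q → ‖z - zb‖ ≤ ε →
      ¬ (∀ i, f i z - f i zb < 0)) :
    ¬ ∃ z : Z,
      (∀ i, fderiv ℝ (f i) zb d = 0 →
        fderiv ℝ (f i) zb z + fderiv ℝ (fderiv ℝ (f i)) zb d d < 0) ∧
      fderiv ℝ G zb z + fderiv ℝ (fderiv ℝ G) zb d d ∈
        secondAdjacentSet Q (G zb) (fderiv ℝ G zb d) := by
  rintro ⟨z, hz, hw⟩
  obtain ⟨ε, hε, hP⟩ := hPareto
  let t : ℕ → ℝ := fun k => 1 / ((k : ℝ) + 1)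
  have ht : ∀ k, 0 < t k := fun k => by positivity
  have ht0 : Tendsto t atTop (𝓝 0) := tendsto_one_div_add_atTop_nhds_zero_nat
  have ht2 : Tendsto (fun k => t k ^ 2) atTop (𝓝 0) := by simpa using ht0.pow 2
  have ht2' : Tendsto (fun k => t k ^ 2 / 2) atTop (𝓝 0) := by simpa using ht2.div_const 2
  obtain ⟨v, hv, hvQ⟩ := hw t ht ht0
  have hGs : HasStrictFDerivAt G (fderiv ℝ G zb) zb :=
    hG.contDiffAt.hasStrictFDerivAt (by norm_num)
  obtain ⟨C, hC, δ, hδ, hreg⟩ :=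
    exists_feasible_near_of_robinson hG.continuous hGs hQcl hQcv hRob
  set x : ℕ → Z := fun k => zb + t k • d + (t k ^ 2 / 2) • z with hxdef
  set q : ℕ → E := fun k => G zb + t k • fderiv ℝ G zb d + (t k ^ 2 / 2) • v k with hqdef
  have hx : Tendsto x atTop (𝓝 zb) := by
    simpa using (tendsto_const_nhds.add (ht0.smul_const d)).add (ht2'.smul_const z)
  have hq : Tendsto q atTop (𝓝 (G zb)) := by
    simpa using (tendsto_const_nhds.add (ht0.smul_const (fderiv ℝ G zb d))).add (ht2'.smul hv)
  have herr : (fun k => G (x k) - q k) =o[atTop] fun k => t k ^ 2 := by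
    have h1 := (hG.isLittleO_parabolic_arc zb d z).comp_tendsto ht0
    have h2 : (fun k => (t k ^ 2 / 2) •
        (fderiv ℝ G zb z + fderiv ℝ (fderiv ℝ G) zb d d - v k)) =o[atTop] fun k => t k ^ 2 := by
      have hv0 : (fun k => fderiv ℝ G zb z + fderiv ℝ (fderiv ℝ G) zb d d - v k)
          =o[atTop] fun _ => (1 : ℝ) := by
        rw [Asymptotics.isLittleO_one_iff]
        rw [← sub_self (fderiv ℝ G zb z + fderiv ℝ (fderiv ℝ G) zb d d)]
        exact tendsto_const_nhds.sub hv
      have hO : (fun k => t k ^ 2 / 2) =O[atTop] fun k => t k ^ 2 := by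
        simpa [div_eq_inv_mul] using
          (Asymptotics.isBigO_refl (fun k => t k ^ 2) atTop).const_mul_left (2⁻¹ : ℝ)
      simpa using hO.smul_isLittleO hv0
    refine (h1.add h2).congr_left fun k => ?_
    simp only [Function.comp_apply, hxdef, hqdef]
    module
  have herr0 : Tendsto (fun k => G (x k) - q k) atTop (𝓝 0) := herr.trans_tendsto ht2
  have hex : ∀ᶠ k in atTop, ∃ x', G x' ∈ Q ∧ ‖x' - x k‖ ≤ C * ‖G (x k) - q k‖ := by
    filter_upwards [hx.eventually (Metric.closedBall_mem_nhds _ hδ),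
      hq.eventually (Metric.closedBall_mem_nhds _ hδ),
      herr0.eventually (Metric.closedBall_mem_nhds _ hδ)] with k h1 h2 h3
    exact hreg (x k) (q k) (hvQ k) (mem_closedBall_iff_norm.1 h1) (mem_closedBall_iff_norm.1 h2)
      (mem_closedBall_zero_iff.1 h3)
  obtain ⟨y, hy⟩ := hex.choice
  have hyx : (fun k => y k - x k) =o[atTop] fun k => t k ^ 2 :=
    (Asymptotics.IsBigO.of_bound C (hy.mono fun k hk => hk.2)).trans_isLittleO herr
  have hylim : Tendsto y atTop (𝓝 zb) := by
    simpa using (hyx.trans_tendsto ht2).add hx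
  have hneg : ∀ i, ∀ᶠ k in atTop, f i (y k) - f i zb < 0 := by
    intro i
    refine eventually_neg_of_isLittleO_second_order ht ht0 (hd.1 i) (hz i) ?_
    have h1 := ((hf i).isLittleO_parabolic_arc zb d z).comp_tendsto ht0
    have hs : HasStrictFDerivAt (f i) (fderiv ℝ (f i) zb) zb :=
      (hf i).contDiffAt.hasStrictFDerivAt (by norm_num)
    have h2 := (hs.isBigO_sub.comp_tendsto (hylim.prodMk_nhds hx)).trans_isLittleO hyx
    refine (h2.add h1).congr_left fun k => ?_
    simp only [Function.comp_apply, hxdef, smul_eq_mul]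
    ring
  obtain ⟨k, h1, h2, h3⟩ := ((eventually_all.2 hneg).and
    ((hylim.eventually (Metric.closedBall_mem_nhds _ hε)).and hy)).exists
  exact hP (y k) h3.1 (mem_closedBall_iff_norm.1 h2) h1
end

section
/- Let z̄ be a feasible point of (MP1) at which the Robinson constraint qualification holds. If z̄ is a locally weak Pareto solution of (MP1), then for each d ∈ C₁*(z̄), the closure of C₀₁(z̄) := {d ∈ Z : ∇f(z̄)d ∈ −ℝ^m₊, ∇G(z̄)d ∈ cone(Q − G(z̄))}, there exists (λ, e*) ∈ Λ₁(z̄) such that ∇²_{zz}𝓛₁(z̄, λ, e*)(d, d) ≥ 0, where 𝓛₁(z, λ, e*) = λᵀ f(z) + ⟨e*, G(z)⟩ and Λ₁(z̄) = {(λ, e*) ∈ ℝ^m₊ × E* : ⟨λ, ∇f(z̄)⟩ + ∇G(z̄)* e* = 0, |λ| = 1, e* ∈ N(Q; G(z̄))}. -/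
open Filter Topology

/-- `cone(A) = {μ a : a ∈ A, μ > 0}`. -/
def posCone {E : Type*} [SMul ℝ E] (A : Set E) : Set E :=
  {x | ∃ μ : ℝ, 0 < μ ∧ ∃ a ∈ A, x = μ • a}

theorem exists_mem_eq_zero_of_halving_step {X : Type*} [MetricSpace X] [CompleteSpace X]
    {S : Set X} (hS : IsClosed S) {φ : X → ℝ} (hφ : Continuous φ) (hφ0 : ∀ x, 0 ≤ φ x)
    {x₀ : X} {κ ρ : ℝ} (hκ : 0 ≤ κ)
    (hstep : ∀ x ∈ S, dist x x₀ ≤ ρ → ∃ x' ∈ S, dist x x' ≤ κ * φ x ∧ φ x' ≤ φ x / 2)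
    {x : X} (hx : x ∈ S) (hxρ : dist x x₀ + 2 * κ * φ x ≤ ρ) :
    ∃ y ∈ S, φ y = 0 ∧ dist x y ≤ 2 * κ * φ x := by
  choose! g hgS hgd hgφ using hstep
  let u : ℕ → X := fun n => g^[n] x
  have hu : ∀ n, u (n + 1) = g (u n) := fun n => Function.iterate_succ_apply' g n x
  have key : ∀ n, u n ∈ S ∧ φ (u n) ≤ φ x / 2 ^ n ∧
      dist x (u n) ≤ 2 * κ * φ x * (1 - 1 / 2 ^ n) := by
    intro n
    induction n with
    | zero => simpa [u] using hx
    | succ n ih =>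
      obtain ⟨h1, h2, h3⟩ := ih
      have hp : (0 : ℝ) < 1 / 2 ^ n := by positivity
      have hnn : 0 ≤ 2 * κ * φ x := by have := hφ0 x; positivity
      have hb : dist (u n) x₀ ≤ ρ := by
        have := dist_triangle_left (u n) x₀ x
        nlinarith
      refine ⟨hu n ▸ hgS _ h1 hb, ?_, ?_⟩
      · rw [hu]
        calc φ (g (u n)) ≤ φ (u n) / 2 := hgφ _ h1 hb
          _ ≤ φ x / 2 ^ n / 2 := by gcongr
          _ = φ x / 2 ^ (n + 1) := by rw [pow_succ, div_div]
      · rw [hu]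
        calc dist x (g (u n)) ≤ dist x (u n) + dist (u n) (g (u n)) := dist_triangle _ _ _
          _ ≤ 2 * κ * φ x * (1 - 1 / 2 ^ n) + κ * (φ x / 2 ^ n) := by
            gcongr
            exact (hgd _ h1 hb).trans (by gcongr)
          _ = 2 * κ * φ x * (1 - 1 / 2 ^ (n + 1)) := by
            field_simp
            ring
  have hnn : 0 ≤ 2 * κ * φ x := by have := hφ0 x; positivity
  have hball : ∀ n, dist (u n) x₀ ≤ ρ := fun n => by
    have hp : (0 : ℝ) < 1 / 2 ^ n := by positivity
    have := dist_triangle_left (u n) x₀ x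
    nlinarith [(key n).2.2]
  have hd : ∀ n, dist (u n) (u (n + 1)) ≤ 2 * κ * φ x / 2 / 2 ^ n := fun n => by
    rw [hu]
    calc dist (u n) (g (u n)) ≤ κ * φ (u n) := hgd _ (key n).1 (hball n)
      _ ≤ κ * (φ x / 2 ^ n) := by gcongr; exact (key n).2.1
      _ = 2 * κ * φ x / 2 / 2 ^ n := by ring
  obtain ⟨y, hy⟩ := cauchySeq_tendsto_of_complete (cauchySeq_of_le_geometric_two hd)
  refine ⟨y, hS.mem_of_tendsto hy (Eventually.of_forall fun n => (key n).1), ?_, ?_⟩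
  · refine le_antisymm ?_ (hφ0 y)
    have h1 : Tendsto (fun n => φ x / 2 ^ n) atTop (𝓝 0) := by
      simpa [div_eq_mul_inv] using
        (tendsto_pow_atTop_nhds_zero_of_lt_one (r := (2 : ℝ)⁻¹) (by norm_num)
          (by norm_num)).const_mul (φ x)
    exact le_of_tendsto_of_tendsto' ((hφ.tendsto y).comp hy) h1 fun n => (key n).2.1
  · exact dist_le_of_le_geometric_two_of_tendsto₀ hd hy

theorem exists_sub_eq_of_robinson {Z E : Type*} [NormedAddCommGroup Z] [NormedSpace ℝ Z]
    [NormedAddCommGroup E] [NormedSpace ℝ E] {Q : Set E} (hQ : Convex ℝ Q)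
    {A : Z →L[ℝ] E} {y₀ : E} {r : ℝ} (hr : 0 < r)
    (h : ∀ e : E, ‖e‖ ≤ r → ∃ u : Z, ‖u‖ ≤ 1 ∧ ∃ q ∈ Q, ‖q - y₀‖ ≤ 1 ∧ A u - (q - y₀) = e)
    {y : E} (hy : y ∈ Q) (hyr : ‖y - y₀‖ ≤ r / 2) {e : E} (he : ‖e‖ ≤ r / 2) :
    ∃ u : Z, ∃ q ∈ Q, ‖u‖ ≤ (2 / r + 1) * ‖e‖ ∧ ‖q - y‖ ≤ (2 / r + 1) * ‖e‖ ∧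
      A u - (q - y) = e := by
  rcases eq_or_ne e 0 with rfl | hne
  · exact ⟨0, y, hy, by simp⟩
  have hen : 0 < ‖e‖ := norm_pos_iff.2 hne
  set s : ℝ := 2 * ‖e‖ / r with hs
  have hs0 : 0 < s := by positivity
  have hs1 : s ≤ 1 := by rw [hs, div_le_one hr]; linarith
  have hn : ‖s⁻¹ • e‖ = r / 2 := by
    rw [norm_smul, Real.norm_of_nonneg (by positivity), hs]
    field_simp
  obtain ⟨u, hu, q, hq, hq1, huq⟩ := h (s⁻¹ • e - (y - y₀))
    ((norm_sub_le _ _).trans (by linarith))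
  have hqy : ‖q - y‖ ≤ 1 + r / 2 := by
    have := norm_sub_le (q - y₀) (y - y₀)
    rw [sub_sub_sub_cancel_right] at this
    linarith
  refine ⟨s • u, y + s • (q - y), ?_, ?_, ?_, ?_⟩
  · exact hQ.add_smul_sub_mem hy hq ⟨hs0.le, hs1⟩
  · rw [norm_smul, Real.norm_of_nonneg hs0.le]
    calc s * ‖u‖ ≤ s * 1 := by gcongr
      _ ≤ (2 / r + 1) * ‖e‖ := by rw [hs]; ring_nf; linarith
  · rw [add_sub_cancel_left, norm_smul, Real.norm_of_nonneg hs0.le]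
    calc s * ‖q - y‖ ≤ s * (1 + r / 2) := by gcongr
      _ = (2 / r + 1) * ‖e‖ := by rw [hs]; field_simp
  · have h2 : A u - (q - y) = s⁻¹ • e := by
      rw [← sub_eq_zero] at huq ⊢
      rw [← huq]; abel
    rw [add_sub_cancel_left, map_smul, ← smul_sub, h2, smul_inv_smul₀ hs0.ne']

theorem exists_feasible_dist_le_of_robinson {Z E : Type*}
    [NormedAddCommGroup Z] [NormedSpace ℝ Z] [CompleteSpace Z]
    [NormedAddCommGroup E] [NormedSpace ℝ E] [CompleteSpace E]
    {G : Z → E} (hGc : Continuous G) {Q : Set E} (hQc : IsClosed Q) (hQ : Convex ℝ Q)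
    {A : Z →L[ℝ] E} {z₀ : Z} (hA : HasStrictFDerivAt G A z₀) {r : ℝ} (hr : 0 < r)
    (h : ∀ e : E, ‖e‖ ≤ r →
      ∃ u : Z, ‖u‖ ≤ 1 ∧ ∃ q ∈ Q, ‖q - G z₀‖ ≤ 1 ∧ A u - (q - G z₀) = e) :
    ∃ κ : ℝ, 0 ≤ κ ∧ ∀ᶠ p : Z × E in 𝓝 (z₀, G z₀), p.2 ∈ Q →
      ∃ z, G z ∈ Q ∧ ‖z - p.1‖ ≤ κ * ‖G p.1 - p.2‖ := by
  set κ : ℝ := 2 / r + 1 with hκ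
  have hκ0 : 0 < κ := by positivity
  let φ : Z × E → ℝ := fun p => ‖G p.1 - p.2‖
  have hφ : Continuous φ := by fun_prop
  have hφz : φ (z₀, G z₀) = 0 := by simp [φ]
  have hstrict : ∀ᶠ p : Z × Z in 𝓝 (z₀, z₀),
      ‖G p.1 - G p.2 - A (p.1 - p.2)‖ ≤ 1 / (2 * κ) * ‖p.1 - p.2‖ :=
    hA.isLittleO.def (by positivity)
  obtain ⟨ρ₁, hρ₁, hG⟩ := Metric.eventually_nhds_iff_ball.1 hstrict
  have hsmall : ∀ᶠ p : Z × E in 𝓝 (z₀, G z₀), φ p < min (r / 2) (ρ₁ / (2 * κ)) :=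
    hφ.continuousAt.eventually_lt continuousAt_const (by rw [hφz]; positivity)
  obtain ⟨ρ₂, hρ₂, hφs⟩ := Metric.eventually_nhds_iff_ball.1 hsmall
  set ρ := min (ρ₂ / 2) (min (r / 2) (ρ₁ / 4)) with hρ
  have hρ0 : 0 < ρ := by positivity
  have hstep : ∀ x ∈ {p : Z × E | p.2 ∈ Q}, dist x (z₀, G z₀) ≤ ρ →
      ∃ x' ∈ {p : Z × E | p.2 ∈ Q}, dist x x' ≤ κ * φ x ∧ φ x' ≤ φ x / 2 := by
    rintro ⟨z, y⟩ hy hd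
    have hy : y ∈ Q := hy
    have hd2 : dist (z, y) (z₀, G z₀) < ρ₂ :=
      (hd.trans (min_le_left _ _)).trans_lt (by linarith)
    have hdr := hd.trans ((min_le_right _ _).trans (min_le_left _ _))
    have hdρ := hd.trans ((min_le_right _ _).trans (min_le_right _ _))
    rw [Prod.dist_eq, max_le_iff] at hdr hdρ
    have hφx := hφs (z, y) hd2
    rw [lt_min_iff] at hφx
    obtain ⟨u, q, hq, hu, hqy, huq⟩ := exists_sub_eq_of_robinson hQ hr h hy
      (by simpa [dist_eq_norm] using hdr.2) (e := -(G z - y)) ((norm_neg _).trans_le hφx.1.le)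
    rw [norm_neg] at hu hqy
    have hu' : ‖u‖ ≤ κ * φ (z, y) := hu
    refine ⟨(z + u, q), hq, ?_, ?_⟩
    · rw [Prod.dist_eq]
      refine max_le ?_ ?_
      · simpa [dist_eq_norm] using hu
      · rwa [dist_comm, dist_eq_norm]
    · have hun : ‖u‖ < ρ₁ / 2 := by
        refine hu'.trans_lt ?_
        calc κ * φ (z, y) < κ * (ρ₁ / (2 * κ)) := by gcongr; exact hφx.2
          _ = ρ₁ / 2 := by field_simp
      have hz : ‖z - z₀‖ ≤ ρ₁ / 4 := by simpa [dist_eq_norm] using hdρ.1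
      have hmem : ((z + u, z) : Z × Z) ∈ Metric.ball (z₀, z₀) ρ₁ := by
        rw [Metric.mem_ball, Prod.dist_eq, max_lt_iff, dist_eq_norm, dist_eq_norm]
        constructor
        · have : z + u - z₀ = (z - z₀) + u := by abel
          simp only [this]
          exact (norm_add_le _ _).trans_lt (by linarith)
        · exact hz.trans_lt (by linarith)
      have herr := hG _ hmem
      simp only [add_sub_cancel_left] at herr
      have heq : G (z + u) - q = G (z + u) - G z - A u := by
        have : A u = q - y - (G z - y) := by
          rw [sub_eq_iff_eq_add] at huq
          rw [huq]; abel
        rw [this]; abel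
      calc φ (z + u, q) = ‖G (z + u) - G z - A u‖ := by simp only [φ, heq]
        _ ≤ 1 / (2 * κ) * ‖u‖ := herr
        _ ≤ 1 / (2 * κ) * (κ * φ (z, y)) := by gcongr
        _ = φ (z, y) / 2 := by field_simp
  refine ⟨2 * κ, by positivity, ?_⟩
  have hclose : ∀ᶠ p : Z × E in 𝓝 (z₀, G z₀), dist p (z₀, G z₀) + 2 * κ * φ p < ρ :=
    ContinuousAt.eventually_lt (by fun_prop) continuousAt_const (by simpa [hφz] using hρ0)
  filter_upwards [hclose] with p hp hpQ
  obtain ⟨⟨z, y⟩, hy, hzero, hdist⟩ := exists_mem_eq_zero_of_halving_step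
    (hQc.preimage continuous_snd) hφ (fun _ => norm_nonneg _) hκ0.le hstep hpQ hp.le
  have hzy : G z = y := sub_eq_zero.1 (norm_eq_zero.1 hzero)
  refine ⟨z, hzy ▸ hy, ?_⟩
  rw [← dist_eq_norm, dist_comm]
  exact (le_max_left _ _).trans hdist

theorem isLittleO_taylor_two_along_parabola {Z F : Type*} [NormedAddCommGroup Z]
    [NormedSpace ℝ Z] [NormedAddCommGroup F] [NormedSpace ℝ F] {h : Z → F}
    (hh : ContDiff ℝ 2 h) (z d w : Z) :
    (fun t : ℝ => h (z + t • d + (t ^ 2 / 2) • w) - h z - t • fderiv ℝ h z d -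
      (t ^ 2 / 2) • (fderiv ℝ h z w + fderiv ℝ (fderiv ℝ h) z d d)) =o[𝓝 0]
      fun t : ℝ => t ^ 2 := by
  set c : ℝ → Z := fun t => z + t • d + (t ^ 2 / 2) • w with hc
  have hc0 : c 0 = z := by simp [hc]
  have hcd : ∀ t, HasDerivAt c (d + t • w) t := fun t => by
    have h1 : HasDerivAt (fun t : ℝ => t ^ 2 / 2) t t := by
      simpa using (hasDerivAt_pow 2 t).div_const 2
    have := (((hasDerivAt_id t).smul_const d).const_add z).add (h1.smul_const w)
    exact this.congr_deriv (by simp)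
  have hφ : ∀ t, HasDerivAt (fun t => h (c t)) (fderiv ℝ h (c t) (d + t • w)) t := fun t =>
    ((hh.differentiable (by norm_num)) (c t)).hasFDerivAt.comp_hasDerivAt t (hcd t)
  have hφ2 : HasDerivAt (fun t => fderiv ℝ h (c t) (d + t • w))
      (fderiv ℝ h z w + fderiv ℝ (fderiv ℝ h) z d d) 0 := by
    have h1 : HasDerivAt (fun t => fderiv ℝ h (c t)) (fderiv ℝ (fderiv ℝ h) z d) 0 := by
      have hd : Differentiable ℝ (fderiv ℝ h) :=
        (hh.fderiv_right (m := 1) (by norm_num)).differentiable (by norm_num)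
      have := (hd (c 0)).hasFDerivAt.comp_hasDerivAt 0 (hcd 0)
      exact this.congr_deriv (by simp [hc0])
    have h2 : HasDerivAt (fun t : ℝ => d + t • w) w 0 := by
      simpa using ((hasDerivAt_id (0 : ℝ)).smul_const w).const_add d
    have := h1.clm_apply h2
    simpa [hc0, add_comm] using this
  set v := fderiv ℝ h z w + fderiv ℝ (fderiv ℝ h) z d d with hv
  have hR : ∀ t, HasDerivAt (fun t => h (c t) - h z - t • fderiv ℝ h z d - (t ^ 2 / 2) • v)
      (fderiv ℝ h (c t) (d + t • w) - fderiv ℝ h z d - t • v) t := fun t => by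
    have h1 : HasDerivAt (fun t : ℝ => t ^ 2 / 2) t t := by
      simpa using (hasDerivAt_pow 2 t).div_const 2
    have := (((hφ t).sub_const (h z)).sub ((hasDerivAt_id t).smul_const (fderiv ℝ h z d))).sub
      (h1.smul_const v)
    exact this.congr_deriv (by simp)
  rw [hasDerivAt_iff_isLittleO] at hφ2
  simp only [hc0, zero_smul, add_zero, sub_zero] at hφ2
  rw [Asymptotics.isLittleO_iff] at hφ2 ⊢
  intro ε hε
  obtain ⟨δ, hδ, hb⟩ := Metric.eventually_nhds_iff_ball.1 (hφ2 hε)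
  filter_upwards [Metric.ball_mem_nhds (0 : ℝ) hδ] with t ht
  have hsub : ∀ s ∈ segment ℝ 0 t, ‖s‖ ≤ ‖t‖ := by
    rintro s ⟨a, b, ha, hb, hab, rfl⟩
    rw [smul_zero, zero_add, smul_eq_mul, norm_mul, Real.norm_of_nonneg hb]
    exact mul_le_of_le_one_left (norm_nonneg _) (by linarith)
  have := (convex_segment (0 : ℝ) t).norm_image_sub_le_of_norm_hasDerivWithin_le
    (C := ε * ‖t‖) (fun s _ => (hR s).hasDerivWithinAt) (fun s hs => by
      refine (hb s ?_).trans (by gcongr; exact hsub s hs)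
      rw [mem_ball_zero_iff] at ht ⊢
      exact (hsub s hs).trans_lt ht) (left_mem_segment ℝ 0 t) (right_mem_segment ℝ 0 t)
  simpa [hc, pow_two, mul_assoc] using this

theorem eventually_neg_of_isLittleO_parabola {Z : Type*} [NormedAddCommGroup Z]
    [NormedSpace ℝ Z] {h : Z → ℝ} (hh : ContDiff ℝ 2 h) {z d w : Z}
    (hd : fderiv ℝ h z d ≤ 0) (hw : fderiv ℝ h z w + fderiv ℝ (fderiv ℝ h) z d d < 0)
    {ρ : ℝ → ℝ} (hρ : ρ =o[𝓝 0] fun t : ℝ => t ^ 2)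
    (hnear : ∀ s ∈ 𝓝 z, ∀ᶠ t in 𝓝[>] (0 : ℝ),
      ∀ z', ‖z' - (z + t • d + (t ^ 2 / 2) • w)‖ ≤ ρ t → z' ∈ s) :
    ∀ᶠ t in 𝓝[>] (0 : ℝ),
      ∀ z', ‖z' - (z + t • d + (t ^ 2 / 2) • w)‖ ≤ ρ t → h z' - h z < 0 := by
  obtain ⟨K, s, hs, hK⟩ :=
    (hh.contDiffAt.hasStrictFDerivAt (x := z) (by norm_num)).exists_lipschitzOnWith
  set c := fderiv ℝ h z w + fderiv ℝ (fderiv ℝ h) z d d with hc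
  set η : ℝ := -c / (4 * (K + 1)) with hη
  have hK0 : (0 : ℝ) ≤ K := K.2
  have hη0 : 0 < η := div_pos (by linarith) (by positivity)
  have hηc : η * (K + 1) = -c / 4 := by rw [hη]; field_simp
  have hzero : ∀ᶠ t in 𝓝[>] (0 : ℝ), 0 ≤ ρ t → z + t • d + (t ^ 2 / 2) • w ∈ s := by
    filter_upwards [hnear s hs] with t ht hρt
    exact ht _ (by simpa using hρt)
  filter_upwards [self_mem_nhdsWithin, hnear s hs, hzero,
    nhdsWithin_le_nhds (hρ.def hη0),
    nhdsWithin_le_nhds ((isLittleO_taylor_two_along_parabola hh z d w).def hη0)]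
    with t ht h1 h2 h3 h4 z' hz'
  have ht : 0 < t := ht
  have ht2 : 0 < t ^ 2 := by positivity
  have hρt : 0 ≤ ρ t := (norm_nonneg _).trans hz'
  have hL := hK.dist_le_mul z' (h1 z' hz') _ (h2 hρt)
  rw [dist_eq_norm, dist_eq_norm] at hL
  rw [Real.norm_of_nonneg hρt, Real.norm_of_nonneg ht2.le] at h3
  rw [Real.norm_of_nonneg ht2.le, ← hc] at h4
  have h5 := (le_abs_self _).trans (hL.trans (mul_le_mul_of_nonneg_left (hz'.trans h3) hK0))
  have h6 := (le_abs_self _).trans h4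
  simp only [smul_eq_mul] at h6
  have h7 : t * fderiv ℝ h z d ≤ 0 := mul_nonpos_of_nonneg_of_nonpos ht.le hd
  have h8 : (K : ℝ) * (η * t ^ 2) + η * t ^ 2 = -c / 4 * t ^ 2 := by rw [← hηc]; ring
  nlinarith

theorem not_exists_second_order_descent {Z E ι : Type*} [Finite ι]
    [NormedAddCommGroup Z] [NormedSpace ℝ Z] [CompleteSpace Z]
    [NormedAddCommGroup E] [NormedSpace ℝ E] [CompleteSpace E]
    {f : ι → Z → ℝ} {G : Z → E} {Q : Set E}
    (hf : ∀ i, ContDiff ℝ 2 (f i)) (hG : ContDiff ℝ 2 G)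
    (hQcl : IsClosed Q) (hQcv : Convex ℝ Q) {zb : Z} (hfeas : G zb ∈ Q)
    {r : ℝ} (hr : 0 < r)
    (hRob : ∀ e : E, ‖e‖ ≤ r →
      ∃ u : Z, ‖u‖ ≤ 1 ∧ ∃ q ∈ Q, ‖q - G zb‖ ≤ 1 ∧ fderiv ℝ G zb u - (q - G zb) = e)
    (hPareto : ∃ ε > 0, ∀ z : Z, G z ∈ Q → ‖z - zb‖ ≤ ε → ¬ (∀ i, f i z - f i zb < 0))
    {d : Z} (hdf : ∀ i, fderiv ℝ (f i) zb d ≤ 0)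
    (hdG : fderiv ℝ G zb d ∈ posCone ((fun q => q - G zb) '' Q)) {w : Z}
    (hwf : ∀ i, fderiv ℝ (f i) zb w + fderiv ℝ (fderiv ℝ (f i)) zb d d < 0) :
    fderiv ℝ G zb w + fderiv ℝ (fderiv ℝ G) zb d d ∉ posCone ((fun q => q - G zb) '' Q) := by
  rintro ⟨ν, hν, _, ⟨q₂, hq₂, rfl⟩, hk⟩
  obtain ⟨μ, hμ, _, ⟨q₁, hq₁, rfl⟩, hd⟩ := hdG
  obtain ⟨ε, hε, hP⟩ := hPareto
  obtain ⟨κ, hκ, hreg⟩ := exists_feasible_dist_le_of_robinson hG.continuous hQcl hQcv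
    (hG.contDiffAt.hasStrictFDerivAt (x := zb) (by norm_num)) hr hRob
  let z : ℝ → Z := fun t => zb + t • d + (t ^ 2 / 2) • w
  let y : ℝ → E := fun t => G zb + (t * μ) • (q₁ - G zb) + (t ^ 2 / 2 * ν) • (q₂ - G zb)
  have hz : Continuous z := by fun_prop
  have hy : Continuous y := by fun_prop
  have hz0 : z 0 = zb := by simp [z]
  have hy0 : y 0 = G zb := by simp [y]
  have hρ : (fun t => κ * ‖G (z t) - y t‖) =o[𝓝 0] fun t : ℝ => t ^ 2 := by
    refine Asymptotics.IsLittleO.const_mul_left (Asymptotics.IsLittleO.norm_left ?_) κ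
    refine (isLittleO_taylor_two_along_parabola hG zb d w).congr_left fun t => ?_
    rw [hk, hd]
    simp only [z, y, smul_smul]
    abel
  have hnear : ∀ s ∈ 𝓝 zb, ∀ᶠ t in 𝓝[>] (0 : ℝ),
      ∀ z', ‖z' - z t‖ ≤ κ * ‖G (z t) - y t‖ → z' ∈ s := by
    intro s hs
    obtain ⟨δ, hδ, hb⟩ := Metric.mem_nhds_iff.1 hs
    have hGc := hG.continuous
    have : ∀ᶠ t in 𝓝 (0 : ℝ), κ * ‖G (z t) - y t‖ + ‖z t - zb‖ < δ :=
      ContinuousAt.eventually_lt (by fun_prop) continuousAt_const (by simpa [hz0, hy0] using hδ)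
    filter_upwards [nhdsWithin_le_nhds this] with t ht z' hz'
    refine hb ?_
    rw [mem_ball_iff_norm]
    calc ‖z' - zb‖ ≤ ‖z' - z t‖ + ‖z t - zb‖ := norm_sub_le_norm_sub_add_norm_sub _ _ _
      _ < δ := by linarith
  have hyQ : ∀ᶠ t in 𝓝[>] (0 : ℝ), y t ∈ Q := by
    have : ∀ᶠ t in 𝓝 (0 : ℝ), t * μ + t ^ 2 / 2 * ν < 1 :=
      ContinuousAt.eventually_lt (by fun_prop) continuousAt_const (by simp)
    filter_upwards [nhdsWithin_le_nhds this, self_mem_nhdsWithin] with t ht ht0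
    have ht0 : 0 < t := ht0
    have hcomb := hQcv.sum_mem (t := Finset.univ)
      (w := ![1 - t * μ - t ^ 2 / 2 * ν, t * μ, t ^ 2 / 2 * ν]) (z := ![G zb, q₁, q₂])
      (by
        intro i _
        fin_cases i
        · simp; linarith
        · simp; positivity
        · simp; positivity)
      (by simp only [Fin.sum_univ_three, Matrix.cons_val]; ring)
      (by intro i _; fin_cases i <;> simpa)
    convert hcomb using 1
    simp only [y, Fin.sum_univ_three, Matrix.cons_val]
    module
  have hreg' : ∀ᶠ t in 𝓝[>] (0 : ℝ), y t ∈ Q →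
      ∃ z', G z' ∈ Q ∧ ‖z' - z t‖ ≤ κ * ‖G (z t) - y t‖ := by
    have ht : Tendsto (fun t => (z t, y t)) (𝓝 0) (𝓝 (zb, G zb)) := by
      have := (hz.prodMk hy).tendsto 0
      rwa [hz0, hy0] at this
    exact nhdsWithin_le_nhds (ht.eventually hreg)
  have hneg := eventually_all.2 fun i =>
    eventually_neg_of_isLittleO_parabola (hf i) (hdf i) (hwf i) hρ hnear
  obtain ⟨t, h1, h2, h3, h4⟩ :=
    (hyQ.and (hreg'.and (hneg.and (hnear _ (Metric.closedBall_mem_nhds zb hε))))).exists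
  obtain ⟨z', hz'Q, hz'⟩ := h2 h1
  exact hP z' hz'Q (by simpa [dist_eq_norm] using h4 z' hz') fun i => h3 i z' hz'

theorem posCone_add_mem {E : Type*} [AddCommGroup E] [Module ℝ E] {K : Set E}
    (hK : Convex ℝ K) {a b : E} (ha : a ∈ posCone K) (hb : b ∈ posCone K) :
    a + b ∈ posCone K := by
  obtain ⟨μ, hμ, a, ha, rfl⟩ := ha
  obtain ⟨ν, hν, b, hb, rfl⟩ := hb
  refine ⟨μ + ν, by positivity, (μ / (μ + ν)) • a + (ν / (μ + ν)) • b,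
    hK ha hb (by positivity) (by positivity) (by field_simp), ?_⟩
  rw [smul_add, smul_smul, smul_smul]
  congr 2 <;> field_simp

theorem posCone_smul_mem {E : Type*} [AddCommGroup E] [Module ℝ E] {K : Set E}
    {a : E} (ha : a ∈ posCone K) {s : ℝ} (hs : 0 < s) : s • a ∈ posCone K := by
  obtain ⟨μ, hμ, a, ha, rfl⟩ := ha
  exact ⟨s * μ, by positivity, a, ha, by rw [smul_smul]⟩

/-- The strict epigraph, in `ℝ^ι × E`, of the linearization `w ↦ (L w, A w)` with respect to
the ordering cone `ℝ^ι₊ × (-C)`. -/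
def linearizedImage {Z E ι : Type*} [NormedAddCommGroup Z] [NormedSpace ℝ Z]
    [NormedAddCommGroup E] [NormedSpace ℝ E]
    (L : ι → Z →L[ℝ] ℝ) (A : Z →L[ℝ] E) (C : Set E) : Set ((ι → ℝ) × E) :=
  {p | ∃ w : Z, ∃ k ∈ C, (∀ i, L i w < p.1 i) ∧ p.2 = A w - k}

theorem isOpen_linearizedImage {Z E ι : Type*} [Finite ι]
    [NormedAddCommGroup Z] [NormedSpace ℝ Z] [NormedAddCommGroup E] [NormedSpace ℝ E]
    (L : ι → Z →L[ℝ] ℝ) (A : Z →L[ℝ] E) {K : Set E} (hK : Convex ℝ K) {κ : ℝ} {r : ℝ}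
    (hr : 0 < r)
    (h : ∀ e : E, ‖e‖ ≤ r → ∃ u : Z, ‖u‖ ≤ κ * ‖e‖ ∧ ∃ k ∈ K, A u - k = e) :
    IsOpen (linearizedImage L A (posCone K)) := by
  rw [isOpen_iff_eventually]
  rintro p ⟨w, k, hk, hL, hp⟩
  have h1 : ∀ᶠ p' in 𝓝 p, ‖p'.2 - p.2‖ < r :=
    ContinuousAt.eventually_lt (by fun_prop) continuousAt_const (by simpa using hr)
  have h2 : ∀ᶠ p' in 𝓝 p, ∀ i, L i w + ‖L i‖ * (κ * ‖p'.2 - p.2‖) < p'.1 i :=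
    eventually_all.2 fun i =>
      ContinuousAt.eventually_lt (by fun_prop) (by fun_prop) (by simpa using hL i)
  filter_upwards [h1, h2] with p' h1 h2
  obtain ⟨u, hu, k', hk', huk⟩ := h _ h1.le
  refine ⟨w + u, k + k', posCone_add_mem hK hk ⟨1, one_pos, k', hk', (one_smul _ _).symm⟩,
    fun i => ?_, ?_⟩
  · rw [map_add]
    refine (add_le_add_right ?_ _).trans_lt (h2 i)
    exact (le_abs_self _).trans (((L i).le_opNorm u).trans (by gcongr))
  · rw [map_add, add_sub_add_comm, huk, ← hp]
    abel

theorem convex_linearizedImage {Z E ι : Type*}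
    [NormedAddCommGroup Z] [NormedSpace ℝ Z] [NormedAddCommGroup E] [NormedSpace ℝ E]
    (L : ι → Z →L[ℝ] ℝ) (A : Z →L[ℝ] E) {C : Set E} (hC : Convex ℝ C) :
    Convex ℝ (linearizedImage L A C) := by
  rintro p ⟨w, k, hk, hL, hp⟩ p' ⟨w', k', hk', hL', hp'⟩ a b ha hb hab
  refine ⟨a • w + b • w', a • k + b • k', hC hk hk' ha hb hab, fun i => ?_, ?_⟩
  · simp only [map_add, map_smul, smul_eq_mul, Prod.fst_add, Prod.smul_fst, Pi.add_apply,
      Pi.smul_apply]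
    rcases ha.eq_or_lt with rfl | ha
    · obtain rfl : b = 1 := by linarith
      simpa using hL' i
    · nlinarith [mul_lt_mul_of_pos_left (hL i) ha, mul_le_mul_of_nonneg_left (hL' i).le hb]
  · simp only [map_add, map_smul, Prod.snd_add, Prod.smul_snd, hp, hp', smul_sub]
    abel

theorem smul_mem_linearizedImage {Z E ι : Type*}
    [NormedAddCommGroup Z] [NormedSpace ℝ Z] [NormedAddCommGroup E] [NormedSpace ℝ E]
    {L : ι → Z →L[ℝ] ℝ} {A : Z →L[ℝ] E} {K : Set E} {p : (ι → ℝ) × E}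
    (hp : p ∈ linearizedImage L A (posCone K)) {s : ℝ} (hs : 0 < s) :
    s • p ∈ linearizedImage L A (posCone K) := by
  obtain ⟨w, k, hk, hL, hp⟩ := hp
  refine ⟨s • w, s • k, posCone_smul_mem hk hs, fun i => ?_, ?_⟩
  · simpa using mul_lt_mul_of_pos_left (hL i) hs
  · simp [hp, smul_sub]

theorem exists_multiplier_of_notMem_linearizedImage {Z E ι : Type*} [Fintype ι]
    [NormedAddCommGroup Z] [NormedSpace ℝ Z] [NormedAddCommGroup E] [NormedSpace ℝ E]
    {L : ι → Z →L[ℝ] ℝ} {A : Z →L[ℝ] E} {K : Set E} (hK : Convex ℝ K) (hK0 : 0 ∈ K)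
    (hopen : IsOpen (linearizedImage L A (posCone K))) {a : ι → ℝ} {b : E}
    (hab : (a, b) ∉ linearizedImage L A (posCone K))
    (hsurj : ∃ w, ∃ k ∈ posCone K, b = A w - k) :
    ∃ (lam : ι → ℝ) (estar : E →L[ℝ] ℝ), (∀ i, 0 ≤ lam i) ∧ lam ≠ 0 ∧
      (∀ k ∈ K, estar k ≤ 0) ∧ (∀ w, ∑ i, lam i * L i w + estar (A w) = 0) ∧
      ∑ i, lam i * a i + estar b ≤ 0 := by
  classical
  have hconv : Convex ℝ (posCone K) := by
    intro x hx y hy s t hs ht hst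
    rcases hs.eq_or_lt with rfl | hs
    · obtain rfl : t = 1 := by linarith
      simpa using hy
    rcases ht.eq_or_lt with rfl | ht
    · obtain rfl : s = 1 := by linarith
      simpa using hx
    exact posCone_add_mem hK (posCone_smul_mem hx hs) (posCone_smul_mem hy ht)
  have hsub : ∀ k ∈ K, k ∈ posCone K := fun k hk => ⟨1, one_pos, k, hk, (one_smul _ _).symm⟩
  obtain ⟨ℓ, hℓ⟩ := geometric_hahn_banach_open_point
    (convex_linearizedImage L A hconv) hopen hab
  let lam : ι → ℝ := fun i => -ℓ (Pi.single i 1, 0)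
  let estar : E →L[ℝ] ℝ := -(ℓ.comp (ContinuousLinearMap.inr ℝ (ι → ℝ) E))
  have hψ : ∀ (x : ι → ℝ) (y : E), ∑ i, lam i * x i + estar y = -ℓ (x, y) := by
    intro x y
    have h1 : (x, y) = ∑ i, x i • ((Pi.single i 1, 0) : (ι → ℝ) × E) + (0, y) := by
      ext1
      · ext j
        simp [Prod.fst_sum, Finset.sum_apply, Pi.single_apply]
      · simp [Prod.snd_sum]
    rw [h1, map_add, map_sum]
    simp only [map_smul]
    simp [lam, estar, mul_comm, add_comm]
  have hlt : ∀ p ∈ linearizedImage L A (posCone K), ∀ s : ℝ, 0 < s →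
      -ℓ (a, b) < s * -ℓ p := by
    intro p hp s hs
    have := hℓ _ (smul_mem_linearizedImage hp hs)
    rw [map_smul, smul_eq_mul] at this
    linarith
  have hnonneg : ∀ p ∈ linearizedImage L A (posCone K), 0 ≤ -ℓ p := by
    intro p hp
    by_contra! hneg
    have h1 := hlt p hp ((|ℓ (a, b)| + 1) / ℓ p) (div_pos (by positivity) (by linarith))
    have h2 : (|ℓ (a, b)| + 1) / ℓ p * -ℓ p = -(|ℓ (a, b)| + 1) := by
      have : ℓ p ≠ 0 := by intro h; simp [h] at hneg
      field_simp
    linarith [le_abs_self (ℓ (a, b))]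
  obtain ⟨w₀, k₀, hk₀, hb⟩ := hsurj
  have hmem₀ : ((fun i => L i w₀ + 1, b) : (ι → ℝ) × E) ∈ linearizedImage L A (posCone K) :=
    ⟨w₀, k₀, hk₀, fun i => by simp, hb⟩
  have hnonpos : -ℓ (a, b) ≤ 0 := by
    have h1 : Tendsto (fun s : ℝ => s * -ℓ (fun i => L i w₀ + 1, b)) (𝓝[>] 0) (𝓝 0) := by
      have : Continuous fun s : ℝ => s * -ℓ (fun i => L i w₀ + 1, b) := by fun_prop
      simpa using (this.tendsto 0).mono_left nhdsWithin_le_nhds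
    refine ge_of_tendsto h1 ?_
    filter_upwards [self_mem_nhdsWithin] with s hs using (hlt _ hmem₀ s hs).le
  have hle : ∀ (x : ι → ℝ) (w : Z), ∀ k ∈ K, (∀ i, L i w ≤ x i) →
      0 ≤ ∑ i, lam i * x i + estar (A w - k) := by
    intro x w k hk hx
    have h1 : Tendsto (fun s : ℝ => ∑ i, lam i * (x i + s) + estar (A w - k)) (𝓝[>] 0)
        (𝓝 (∑ i, lam i * x i + estar (A w - k))) := by
      have : Continuous fun s : ℝ => ∑ i, lam i * (x i + s) + estar (A w - k) := by fun_prop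
      simpa using (this.tendsto 0).mono_left nhdsWithin_le_nhds
    refine ge_of_tendsto h1 ?_
    filter_upwards [self_mem_nhdsWithin] with s hs
    have hs : 0 < s := hs
    rw [hψ (fun i => x i + s)]
    exact hnonneg _ ⟨w, k, hsub k hk, fun i => (hx i).trans_lt (by simpa using hs), rfl⟩
  refine ⟨lam, estar, fun i => ?_, fun h => ?_, fun k hk => ?_, fun w => ?_, ?_⟩
  · have := hle (Pi.single i 1) 0 0 hK0 fun j => by
      rw [map_zero]
      exact (Pi.single_nonneg.2 zero_le_one : (0 : ι → ℝ) ≤ Pi.single i 1) j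
    simpa [Pi.single_apply] using this
  · have h1 := hlt _ hmem₀ 1 one_pos
    rw [one_mul, ← hψ, ← hψ, h] at h1
    simp at h1
  · have := hle 0 0 k hk fun j => by simp
    simpa using this
  · have h1 := hle (fun i => L i w) w 0 hK0 fun _ => le_rfl
    have h2 := hle (fun i => L i (-w)) (-w) 0 hK0 fun _ => le_rfl
    simp only [map_neg, mul_neg, Finset.sum_neg_distrib, sub_zero] at h1 h2
    linarith
  · rw [hψ]
    exact hnonpos

/-- Second-order necessary optimality condition for (MP1): if `z̄` is a locally weak
Pareto solution satisfying the Robinson constraint qualification, then for each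
`d ∈ C₁*(z̄) = closure C₀₁(z̄)` there is a normalized KKT multiplier `(λ, e*) ∈ Λ₁(z̄)`
with `∇²_{zz} 𝓛₁(z̄, λ, e*)(d, d) ≥ 0`. -/
theorem secondOrder_necessary_condition_MP1
    {Z E : Type*} [NormedAddCommGroup Z] [NormedSpace ℝ Z] [CompleteSpace Z]
    [NormedAddCommGroup E] [NormedSpace ℝ E] [CompleteSpace E]
    {m : ℕ} (f : Fin m → Z → ℝ) (G : Z → E) (Q : Set E)
    (hf : ∀ i, ContDiff ℝ 2 (f i)) (hG : ContDiff ℝ 2 G)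
    (hQne : Q.Nonempty) (hQcl : IsClosed Q) (hQcv : Convex ℝ Q)
    (zb : Z) (hfeas : G zb ∈ Q)
    (hRob : (0 : E) ∈ interior (Set.image2 (fun a b => a - b)
      ((fderiv ℝ G zb) '' Metric.closedBall 0 1)
      (((fun q => q - G zb) '' Q) ∩ Metric.closedBall 0 1)))
    (hPareto : ∃ ε > 0, ∀ z : Z, G z ∈ Q → ‖z - zb‖ ≤ ε →
      ¬ (∀ i, f i z - f i zb < 0)) :
    ∀ d ∈ closure {d : Z | (∀ i, fderiv ℝ (f i) zb d ≤ 0) ∧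
        fderiv ℝ G zb d ∈ posCone ((fun q => q - G zb) '' Q)},
      ∃ (lam : Fin m → ℝ) (estar : E →L[ℝ] ℝ),
        (∀ i, 0 ≤ lam i) ∧ (∑ i, lam i ^ 2 = 1) ∧
        (∀ q ∈ Q, estar (q - G zb) ≤ 0) ∧
        (∀ z : Z, (∑ i, lam i * fderiv ℝ (f i) zb z) + estar (fderiv ℝ G zb z) = 0) ∧
        0 ≤ (∑ i, lam i * fderiv ℝ (fderiv ℝ (f i)) zb d d) +
            estar (fderiv ℝ (fderiv ℝ G) zb d d) := by
  obtain ⟨r, hr, hball⟩ := Metric.mem_nhds_iff.1 (mem_interior_iff_mem_nhds.1 hRob)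
  have hRob' : ∀ e : E, ‖e‖ ≤ r / 2 → ∃ u : Z, ‖u‖ ≤ 1 ∧ ∃ q ∈ Q, ‖q - G zb‖ ≤ 1 ∧
      fderiv ℝ G zb u - (q - G zb) = e := by
    intro e he
    obtain ⟨_, ⟨u, hu, rfl⟩, _, ⟨⟨q, hq, rfl⟩, hq1⟩, heq⟩ :=
      hball (mem_ball_zero_iff.2 (he.trans_lt (by linarith)))
    exact ⟨u, by simpa using hu, q, hq, by simpa using hq1, heq⟩
  set K : Set E := (fun q => q - G zb) '' Q with hKdef
  have hK : Convex ℝ K := by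
    simpa [hKdef, sub_eq_add_neg] using hQcv.translate_preimage_left (G zb)
  have hK0 : (0 : E) ∈ K := ⟨G zb, hfeas, sub_self _⟩
  let A := fderiv ℝ G zb
  let L : Fin m → Z →L[ℝ] ℝ := fun i => fderiv ℝ (f i) zb
  have hopen : IsOpen (linearizedImage L A (posCone K)) := by
    refine isOpen_linearizedImage L A hK (κ := 2 / (r / 2) + 1) (r := r / 2 / 2)
      (by positivity) fun e he => ?_
    obtain ⟨u, q, hq, hu, -, h⟩ := exists_sub_eq_of_robinson hQcv (half_pos hr) hRob' hfeas
      (by rw [sub_self, norm_zero]; positivity) he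
    exact ⟨u, hu, _, ⟨q, hq, rfl⟩, h⟩
  let p : Z → (Fin m → ℝ) × E := fun d =>
    (fun i => -fderiv ℝ (fderiv ℝ (f i)) zb d d, -fderiv ℝ (fderiv ℝ G) zb d d)
  have hp : Continuous p := by fun_prop
  intro d hd
  have hnot : p d ∉ linearizedImage L A (posCone K) := by
    refine closure_minimal (t := {d | p d ∉ linearizedImage L A (posCone K)}) ?_
      (hopen.preimage hp).isClosed_compl hd
    rintro d ⟨hdf, hdG⟩ ⟨w, k, hk, hL, hpk⟩
    refine not_exists_second_order_descent hf hG hQcl hQcv hfeas (half_pos hr) hRob' hPareto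
      hdf hdG (w := w) (fun i => ?_) ?_
    · have := hL i
      simp only [p, L] at this
      linarith
    · have h1 : A w = k - fderiv ℝ (fderiv ℝ G) zb d d := by
        have h2 : -fderiv ℝ (fderiv ℝ G) zb d d = A w - k := hpk
        rw [sub_eq_add_neg, h2, add_sub_cancel]
      change A w + _ ∈ _
      rw [h1, sub_add_cancel]
      exact hk
  have hsurj : ∀ b : E, ∃ w, ∃ k ∈ posCone K, b = A w - k := by
    intro b
    set s : ℝ := r / 2 / (‖b‖ + 1) with hs
    have hs0 : 0 < s := by positivity
    obtain ⟨u, -, q, hq, -, h⟩ := hRob' (s • b) (by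
      rw [norm_smul, Real.norm_of_nonneg hs0.le, hs, div_mul_eq_mul_div,
        div_le_iff₀ (by positivity)]
      nlinarith [norm_nonneg b])
    refine ⟨s⁻¹ • u, s⁻¹ • (q - G zb), ⟨s⁻¹, inv_pos.2 hs0, _, ⟨q, hq, rfl⟩, rfl⟩, ?_⟩
    rw [map_smul, ← smul_sub, h, inv_smul_smul₀ hs0.ne']
  obtain ⟨lam, estar, hlam, hne, hN, hstat, hsec⟩ :=
    exists_multiplier_of_notMem_linearizedImage hK hK0 hopen hnot (hsurj _)
  have hpos : 0 < ∑ i, lam i ^ 2 := by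
    obtain ⟨i, hi⟩ := Function.ne_iff.1 hne
    exact Finset.sum_pos' (fun _ _ => sq_nonneg _) ⟨i, Finset.mem_univ i, sq_pos_of_ne_zero hi⟩
  set c : ℝ := (√(∑ i, lam i ^ 2))⁻¹ with hc
  have hc0 : 0 < c := inv_pos.2 (Real.sqrt_pos.2 hpos)
  refine ⟨fun i => c * lam i, c • estar, fun i => mul_nonneg hc0.le (hlam i), ?_,
    fun q hq => ?_, fun z => ?_, ?_⟩
  · simp only [mul_pow, ← Finset.mul_sum]
    rw [hc, inv_pow, Real.sq_sqrt hpos.le, inv_mul_cancel₀ hpos.ne']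
  · exact mul_nonpos_of_nonneg_of_nonpos hc0.le (hN _ ⟨q, hq, rfl⟩)
  · simp only [mul_assoc, ← Finset.mul_sum, _root_.smul_apply, smul_eq_mul,
      ← mul_add]
    exact mul_eq_zero_of_right _ (hstat z)
  · simp only [mul_assoc, ← Finset.mul_sum, _root_.smul_apply, smul_eq_mul,
      ← mul_add]
    refine mul_nonneg hc0.le ?_
    simp only [mul_neg, Finset.sum_neg_distrib, map_neg] at hsec
    linarith
end

section
/- Let z̄ be a feasible point of (MP1) at which the Robinson constraint qualification holds, and let d ∈ Z satisfy ∇G(z̄)d ∈ cone(Q − G(z̄)). Then E = ∇G(z̄)(Z) − T^{2♭}(Q; G(z̄), ∇G(z̄)d), i.e. every element of E can be written as ∇G(z̄)z − v with z ∈ Z and v ∈ T^{2♭}(Q; G(z̄), ∇G(z̄)d). -/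
open Filter Topology

/-- Near a point `x` of a convex set, the cone of feasible directions consists of second-order
adjacent tangents along every feasible direction. -/
theorem posCone_subset_secondAdjacentSet {X : Type*} [NormedAddCommGroup X] [NormedSpace ℝ X]
    {Q : Set X} (hQ : Convex ℝ Q) {x h : X} (hx : x ∈ Q)
    (hh : h ∈ posCone ((fun q => q - x) '' Q)) :
    posCone ((fun q => q - x) '' Q) ⊆ secondAdjacentSet Q x h := by
  obtain ⟨μ, hμ, _, ⟨p, hp, rfl⟩, rfl⟩ := hh
  rintro _ ⟨ν, hν, _, ⟨q, hq, rfl⟩, rfl⟩ t ht ht0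
  have hcoeff : ∀ᶠ k in atTop, t k * μ + t k ^ 2 / 2 * ν < 1 := by
    have hlim : Tendsto (fun k => t k * μ + t k ^ 2 / 2 * ν) atTop (𝓝 0) := by
      simpa using (ht0.mul_const μ).add (((ht0.pow 2).div_const 2).mul_const ν)
    exact hlim.eventually_lt_const one_pos
  have hmem : ∀ᶠ k in atTop,
      x + t k • μ • (p - x) + (t k ^ 2 / 2) • ν • (q - x) ∈ Q := by
    filter_upwards [hcoeff] with k hk
    have hα : 0 ≤ t k * μ := mul_nonneg (ht k).le hμ.le
    have hβ : 0 ≤ t k ^ 2 / 2 * ν := by positivity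
    have hconv := hQ.sum_mem (t := Finset.univ)
      (w := ![1 - (t k * μ + t k ^ 2 / 2 * ν), t k * μ, t k ^ 2 / 2 * ν]) (z := ![x, p, q])
      (by intro i _; fin_cases i <;> simp <;> linarith)
      (by simp [Fin.sum_univ_three]; ring)
      (by intro i _; fin_cases i <;> simp [hx, hp, hq])
    simp only [Fin.sum_univ_three, Matrix.cons_val] at hconv
    convert hconv using 1
    module
  classical
  refine ⟨fun k => if x + t k • μ • (p - x) + (t k ^ 2 / 2) • ν • (q - x) ∈ Q
    then ν • (q - x) else -((t k ^ 2 / 2)⁻¹ • t k • μ • (p - x)), ?_, fun k => ?_⟩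
  · refine tendsto_const_nhds.congr' ?_
    filter_upwards [hmem] with k hk
    exact (if_pos hk).symm
  · dsimp only
    split_ifs with hk
    · exact hk
    · have hne : t k ^ 2 / 2 ≠ 0 := by have := ht k; positivity
      rw [smul_neg, smul_inv_smul₀ hne, add_neg_cancel_right]
      exact hx

/-- Under the Robinson constraint qualification at a feasible point `z̄`, and for a
direction `d` with `∇G(z̄)d ∈ cone(Q − G(z̄))`, one has
`E = ∇G(z̄)(Z) − T^{2♭}(Q; G(z̄), ∇G(z̄)d)`. -/
theorem surjectivity_secondAdjacent_decomposition
    {Z E : Type*} [NormedAddCommGroup Z] [NormedSpace ℝ Z] [CompleteSpace Z]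
    [NormedAddCommGroup E] [NormedSpace ℝ E] [CompleteSpace E]
    (G : Z → E) (Q : Set E) (hG : ContDiff ℝ 2 G)
    (hQne : Q.Nonempty) (hQcl : IsClosed Q) (hQcv : Convex ℝ Q)
    (zb : Z) (hfeas : G zb ∈ Q)
    (hRob : (0 : E) ∈ interior (Set.image2 (fun a b => a - b)
      ((fderiv ℝ G zb) '' Metric.closedBall 0 1)
      (((fun q => q - G zb) '' Q) ∩ Metric.closedBall 0 1)))
    (d : Z) (hd : fderiv ℝ G zb d ∈ posCone ((fun q => q - G zb) '' Q)) :
    ∀ e : E, ∃ (z : Z) (v : E),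
      v ∈ secondAdjacentSet Q (G zb) (fderiv ℝ G zb d) ∧
      e = fderiv ℝ G zb z - v := by
  intro e
  have hlim : Tendsto (fun s : ℝ => s • e) (𝓝[>] 0) (𝓝 0) := by
    have : Tendsto (fun s : ℝ => s • e) (𝓝 0) (𝓝 ((0 : ℝ) • e)) :=
      tendsto_id.smul_const e
    rw [zero_smul] at this
    exact this.mono_left nhdsWithin_le_nhds
  obtain ⟨s, ⟨_, ⟨a, _, rfl⟩, b, ⟨hb, _⟩, hab⟩, hs⟩ :=
    ((hlim.eventually (mem_interior_iff_mem_nhds.mp hRob)).and self_mem_nhdsWithin).exists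
  have hs : 0 < s := hs
  refine ⟨s⁻¹ • a, s⁻¹ • b,
    posCone_subset_secondAdjacentSet hQcv hfeas hd ⟨s⁻¹, inv_pos.mpr hs, b, hb, rfl⟩, ?_⟩
  rw [map_smul, ← smul_sub]
  exact (eq_inv_smul_iff₀ hs.ne').mpr hab.symm
end

section
/- Let z₀ = (x₀, u₀) be a feasible point of (MP2) satisfying assumptions (A1)–(A3). If z₀ is a locally weak Pareto solution of (MP2), then for each d in the critical cone C₂(z₀), defined as the closure in Z of C₀₂(z₀) := {d ∈ Z : ∇I(z₀)d ∈ −ℝ^m₊, ∇F(z₀)d = 0, ∇G(z₀)d ∈ cone(Q − G(z₀))}, there exists a triple (λ, v*, e*) ∈ ℝ^m₊ × E₀* × E* with |λ| = 1, ∇_z𝓛₂(z₀, λ, v*, e*) = 0 and e* ∈ N(Q; G(z₀)), such that ∇²_{zz}𝓛₂(z₀, λ, v*, e*)(d, d) = ⟨λ, ∇²I(z₀)(d,d)⟩ + ⟨v*, ∇²F(z₀)(d,d)⟩ + ⟨e*, ∇²G(z₀)(d,d)⟩ ≥ 0, where 𝓛₂(z, λ, v*, e*) = ⟨λ, I(z)⟩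 + ⟨v*, F(z)⟩ + ⟨e*, G(z)⟩. -/
open Filter Topology

/-- The quadratic map of a continuous bilinear map is continuous, in `Tendsto` form. -/
theorem ContinuousLinearMap.tendsto_apply_apply_self {α Z W : Type*} [NormedAddCommGroup Z]
    [NormedSpace ℝ Z] [NormedAddCommGroup W] [NormedSpace ℝ W] (B : Z →L[ℝ] Z →L[ℝ] W)
    {l : Filter α} {v : α → Z} {d : Z} (hv : Tendsto v l (𝓝 d)) :
    Tendsto (fun k => B (v k) (v k)) l (𝓝 (B d d)) := by
  have hB : Continuous fun v => B v v := by fun_prop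
  exact (hB.tendsto d).comp hv

/-- Second-order Taylor expansion with Peano remainder. -/
theorem ContDiffAt.taylor_two_isLittleO {Z W : Type*} [NormedAddCommGroup Z] [NormedSpace ℝ Z]
    [NormedAddCommGroup W] [NormedSpace ℝ W] {f : Z → W} {z : Z} (hf : ContDiffAt ℝ 2 f z) :
    (fun x => f x - f z - fderiv ℝ f z (x - z)
      - (1 / 2 : ℝ) • fderiv ℝ (fderiv ℝ f) z (x - z) (x - z)) =o[𝓝 z] fun x => ‖x - z‖ ^ 2 := by
  have hsym : IsSymmSndFDerivAt ℝ f z := hf.isSymmSndFDerivAt (by simp)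
  have hd : ∀ᶠ x in 𝓝 z, DifferentiableAt ℝ f x :=
    (hf.eventually (by simp)).mono fun x hx => hx.differentiableAt (by simp)
  obtain ⟨r, hr, hball⟩ := Metric.eventually_nhds_iff_ball.1 hd
  have hd2 : HasFDerivAt (fderiv ℝ f) (fderiv ℝ (fderiv ℝ f) z) z :=
    ((hf.fderiv_right (m := 1) (by norm_num)).differentiableAt (by simp)).hasFDerivAt
  have hz : z ∈ Metric.ball z r := Metric.mem_ball_self hr
  have key := (convex_ball z r).isLittleO_pow_succ (n := 1) hz
    (f := fun x => f x - fderiv ℝ f z (x - z)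
      - (1 / 2 : ℝ) • fderiv ℝ (fderiv ℝ f) z (x - z) (x - z))
    (f' := fun x => fderiv ℝ f x - fderiv ℝ f z - fderiv ℝ (fderiv ℝ f) z (x - z)) ?_ ?_
  · rw [nhdsWithin_eq_nhds.2 (Metric.ball_mem_nhds z hr)] at key
    refine key.congr_left fun x => ?_
    simp only [sub_self, map_zero, smul_zero, sub_zero]
    abel
  · intro x hx
    have h1 : HasFDerivAt (fun x => x - z) (ContinuousLinearMap.id ℝ Z) x :=
      (hasFDerivAt_id x).sub_const z
    have h2 := (fderiv ℝ (fderiv ℝ f) z).hasFDerivAt.comp x h1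
    have h3 := (h2.clm_apply h1).const_smul (1 / 2 : ℝ)
    have h4 := (fderiv ℝ f z).hasFDerivAt.comp x h1
    refine (((hball x hx).hasFDerivAt.sub h4).sub h3).hasFDerivWithinAt.congr_fderiv ?_
    ext v
    have hs : fderiv ℝ (fderiv ℝ f) z v (x - z) = fderiv ℝ (fderiv ℝ f) z (x - z) v :=
      hsym.eq v (x - z)
    simp [← two_smul ℝ, smul_smul, -map_sub, hs]
  · rw [nhdsWithin_eq_nhds.2 (Metric.ball_mem_nhds z hr)]
    simpa using hd2.isLittleO.norm_right

/-- Second-order expansion of `f` along a curve with prescribed first and second order terms. -/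
theorem ContDiffAt.isLittleO_along_curve {Z W : Type*} [NormedAddCommGroup Z] [NormedSpace ℝ Z]
    [NormedAddCommGroup W] [NormedSpace ℝ W] {f : Z → W} {z d w : Z} (hf : ContDiffAt ℝ 2 f z)
    {γ : ℝ → Z}
    (hγ : (fun t => γ t - (z + t • d + (t ^ 2 / 2) • w)) =o[𝓝[>] (0 : ℝ)] fun t => t ^ 2) :
    (fun t => f (γ t) - (f z + t • fderiv ℝ f z d
      + (t ^ 2 / 2) • (fderiv ℝ f z w + fderiv ℝ (fderiv ℝ f) z d d)))
      =o[𝓝[>] (0 : ℝ)] fun t => t ^ 2 := by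
  have hpos : ∀ᶠ t : ℝ in 𝓝[>] 0, 0 < t := eventually_mem_nhdsWithin
  have ht0 : Tendsto (fun t : ℝ => t) (𝓝[>] 0) (𝓝 0) := nhdsWithin_le_nhds
  have hsq : (fun t : ℝ => t ^ 2) =o[𝓝[>] 0] fun t => t := by
    simpa using (Asymptotics.isLittleO_pow_pow (𝕜 := ℝ) (m := 1) (n := 2) (by norm_num)).mono
      (nhdsWithin_le_nhds (s := Set.Ioi 0))
  have hlin : (fun t => γ t - z - t • d) =o[𝓝[>] (0 : ℝ)] fun t => t := by
    have h1 : (fun t : ℝ => (t ^ 2 / 2) • w) =o[𝓝[>] 0] fun t => t := by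
      refine Asymptotics.IsBigO.trans_isLittleO ?_ hsq
      refine Asymptotics.IsBigO.of_bound ‖w‖ (Eventually.of_forall fun t => ?_)
      rw [norm_smul, norm_div, mul_comm]
      gcongr
      simpa using (half_le_self (sq_nonneg t))
    refine ((hγ.trans hsq).add h1).congr_left fun t => ?_
    abel
  have hv : Tendsto (fun t => t⁻¹ • (γ t - z)) (𝓝[>] (0 : ℝ)) (𝓝 d) := by
    have h1 := hlin.tendsto_inv_smul_nhds_zero
    have h2 := h1.add_const d
    rw [zero_add] at h2
    refine h2.congr' ?_
    filter_upwards [hpos] with t ht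
    rw [smul_sub, smul_smul, inv_mul_cancel₀ ht.ne', one_smul, sub_add_cancel]
  have hO : (fun t => γ t - z) =O[𝓝[>] (0 : ℝ)] fun t => t := by
    have h1 : (fun t : ℝ => t • d) =O[𝓝[>] (0 : ℝ)] fun t => t := by
      refine Asymptotics.IsBigO.of_bound ‖d‖ (Eventually.of_forall fun t => ?_)
      rw [norm_smul, mul_comm]
    refine (hlin.isBigO.add h1).congr_left fun t => ?_
    abel
  have hγ0 : Tendsto γ (𝓝[>] (0 : ℝ)) (𝓝 z) := by
    have := (hO.trans_tendsto ht0).add_const z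
    simpa using this
  have h1 : (fun t => f (γ t) - f z - fderiv ℝ f z (γ t - z)
      - (1 / 2 : ℝ) • fderiv ℝ (fderiv ℝ f) z (γ t - z) (γ t - z)) =o[𝓝[>] (0 : ℝ)]
      fun t => t ^ 2 :=
    (hf.taylor_two_isLittleO.comp_tendsto hγ0).trans_isBigO (hO.norm_left.pow 2)
  have h2 : (fun t => fderiv ℝ f z (γ t - (z + t • d + (t ^ 2 / 2) • w))) =o[𝓝[>] (0 : ℝ)]
      fun t => t ^ 2 := ((fderiv ℝ f z).isBigO_comp _ _).trans_isLittleO hγ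
  have h3 : (fun t => (1 / 2 : ℝ) • (fderiv ℝ (fderiv ℝ f) z (γ t - z) (γ t - z)
      - t ^ 2 • fderiv ℝ (fderiv ℝ f) z d d)) =o[𝓝[>] (0 : ℝ)] fun t => t ^ 2 := by
    refine Asymptotics.IsLittleO.const_smul_left ?_ _
    have hlim : Tendsto (fun t => fderiv ℝ (fderiv ℝ f) z (t⁻¹ • (γ t - z)) (t⁻¹ • (γ t - z))
        - fderiv ℝ (fderiv ℝ f) z d d) (𝓝[>] (0 : ℝ)) (𝓝 0) := by
      simpa using ((fderiv ℝ (fderiv ℝ f) z).tendsto_apply_apply_self hv).sub_const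
        (fderiv ℝ (fderiv ℝ f) z d d)
    have h4 := (Asymptotics.isBigO_refl (fun t : ℝ => t ^ 2) (𝓝[>] 0)).smul_isLittleO
      ((Asymptotics.isLittleO_one_iff ℝ).2 hlim)
    simp only [smul_eq_mul, mul_one] at h4
    refine h4.congr' ?_ EventuallyEq.rfl
    filter_upwards [hpos] with t ht
    generalize γ t - z = u
    have ht2 : t ^ 2 * (t⁻¹ * t⁻¹) = 1 := by field_simp
    rw [map_smul, map_smul, smul_apply, smul_sub, smul_smul, smul_smul, mul_assoc, ht2, one_smul]
  refine ((h1.add h2).add h3).congr_left fun t => ?_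
  have hlin' : γ t - (z + t • d + (t ^ 2 / 2) • w) = (γ t - z) - t • d - (t ^ 2 / 2) • w := by
    abel
  rw [hlin']
  generalize γ t - z = u
  simp only [map_sub, map_smul]
  module

/-- A strictly differentiable map with surjective derivative is metrically regular. -/
theorem HasStrictFDerivAt.exists_metric_regularity {Z Y : Type*} [NormedAddCommGroup Z]
    [NormedSpace ℝ Z] [CompleteSpace Z] [NormedAddCommGroup Y] [NormedSpace ℝ Y] [CompleteSpace Y]
    {H : Z → Y} {A : Z →L[ℝ] Y} {z : Z} (hH : HasStrictFDerivAt H A z)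
    (hA : Function.Surjective A) :
    ∃ C : ℝ, ∀ᶠ q : Z × Y in 𝓝 (z, H z), ∃ x, H x = q.2 ∧ ‖x - q.1‖ ≤ C * ‖H q.1 - q.2‖ := by
  obtain ⟨R, hR⟩ := A.exists_nonlinearRightInverse_of_surjective (LinearMap.range_eq_top.2 hA)
  have hc : 0 < R.nnnorm⁻¹ / 2 := half_pos (inv_pos.2 hR)
  obtain ⟨s, hs, happ⟩ := hH.approximates_deriv_on_nhds (Or.inr hc)
  obtain ⟨r, hr, hrs⟩ := Metric.mem_nhds_iff.1 hs
  have hRpos : (0 : ℝ) < R.nnnorm := hR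
  refine ⟨2 * R.nnnorm, ?_⟩
  have hcont : Tendsto (fun q : Z × Y => dist q.1 z + 2 * R.nnnorm * ‖H q.1 - q.2‖)
      (𝓝 (z, H z)) (𝓝 0) := by
    have hH1 : ContinuousAt (fun q : Z × Y => H q.1) (z, H z) :=
      hH.continuousAt.comp (f := Prod.fst) continuousAt_fst
    have : ContinuousAt (fun q : Z × Y => dist q.1 z + 2 * R.nnnorm * ‖H q.1 - q.2‖)
        (z, H z) :=
      (continuousAt_fst.dist continuousAt_const).add
        (continuousAt_const.mul (hH1.sub continuousAt_snd).norm)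
    simpa [ContinuousAt] using this
  filter_upwards [hcont.eventually (gt_mem_nhds hr)] with q hq
  have hsub : Metric.closedBall q.1 (2 * R.nnnorm * ‖H q.1 - q.2‖) ⊆ s := by
    intro x hx
    apply hrs
    rw [Metric.mem_closedBall] at hx
    rw [Metric.mem_ball]
    linarith [dist_triangle x q.1 z]
  obtain ⟨x, hx, hxq⟩ := happ.surjOn_closedBall_of_nonlinearRightInverse R (by positivity) hsub
    (show q.2 ∈ _ by
      rw [Metric.mem_closedBall, dist_comm, dist_eq_norm]
      push_cast
      apply le_of_eq
      field_simp
      ring)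
  exact ⟨x, hxq, by simpa [dist_eq_norm] using hx⟩

/-- Precomposition with a surjective continuous linear map between Banach spaces is a closed
embedding of the duals. -/
theorem isClosedEmbedding_precomp_of_surjective {Z Y : Type*} [NormedAddCommGroup Z]
    [NormedSpace ℝ Z] [CompleteSpace Z] [NormedAddCommGroup Y] [NormedSpace ℝ Y] [CompleteSpace Y]
    (A : Z →L[ℝ] Y) (hA : Function.Surjective A) :
    IsClosedEmbedding fun φ : Y →L[ℝ] ℝ => φ.comp A := by
  obtain ⟨C, hC, hinv⟩ := A.exists_preimage_norm_le hA
  have hanti : AntilipschitzWith ⟨C, hC.le⟩ ((ContinuousLinearMap.compL ℝ Z Y ℝ).flip A) := by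
    refine AddMonoidHomClass.antilipschitz_of_bound _ fun φ => ?_
    refine φ.opNorm_le_bound (by positivity) fun y => ?_
    obtain ⟨x, rfl, hx⟩ := hinv y
    calc ‖φ (A x)‖ ≤ ‖φ.comp A‖ * ‖x‖ := (φ.comp A).le_opNorm x
      _ ≤ ‖φ.comp A‖ * (C * ‖A x‖) := by gcongr
      _ = C * ‖φ.comp A‖ * ‖A x‖ := by ring
  exact hanti.isClosedEmbedding ((ContinuousLinearMap.compL ℝ Z Y ℝ).flip A).uniformContinuous

/-- Multiplier rule for a linear system of strict inequalities with a surjective conic constraint. -/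
theorem exists_multiplier_of_linear_alternative {ι Z Y : Type*} [Fintype ι] [NormedAddCommGroup Z]
    [NormedSpace ℝ Z] [CompleteSpace Z] [NormedAddCommGroup Y] [NormedSpace ℝ Y] [CompleteSpace Y]
    (L : ι → Z →L[ℝ] ℝ) (a : ι → ℝ) (A : Z →L[ℝ] Y) (hA : Function.Surjective A) (b : Y)
    (K : Set Y) (hKcv : Convex ℝ K) (hK0 : 0 ∈ K) (hK : ∀ y ∈ K, ∀ r : ℝ, 0 < r → r • y ∈ K)
    (h : ∀ w, A w + b ∈ K → ¬ ∀ i, L i w + a i < 0) :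
    ∃ (lam : ι → ℝ) (φ : Y →L[ℝ] ℝ), (∀ i, 0 ≤ lam i) ∧ (∑ i, lam i ^ 2 = 1) ∧
      (∀ y ∈ K, φ y ≤ 0) ∧ (∀ w, ∑ i, lam i * L i w + φ (A w) = 0) ∧
      0 ≤ ∑ i, lam i * a i + φ b := by
  classical
  let T : Z × (ι → ℝ) →L[ℝ] (ι → ℝ) × Y :=
    (((ContinuousLinearMap.pi L).comp (ContinuousLinearMap.fst ℝ Z (ι → ℝ))
      + ContinuousLinearMap.snd ℝ Z (ι → ℝ)).prod
      (A.comp (ContinuousLinearMap.fst ℝ Z (ι → ℝ))))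
  have hT : ∀ w s, T (w, s) = (fun i => L i w + s i, A w) := fun w s => rfl
  have hTsurj : Function.Surjective T := by
    rintro ⟨s, y⟩
    obtain ⟨w, rfl⟩ := hA y
    exact ⟨(w, fun i => s i - L i w), by rw [hT]; simp⟩
  let P : Set (Z × (ι → ℝ)) := Set.univ ×ˢ Set.univ.pi fun _ => Set.Ioi 0
  have hPo : IsOpen P := isOpen_univ.prod (isOpen_set_pi Set.finite_univ fun _ _ => isOpen_Ioi)
  have hPc : Convex ℝ P := convex_univ.prod (convex_pi fun _ _ => convex_Ioi 0)
  let N : Set ((ι → ℝ) × Y) := (fun y => (a, b - y)) '' K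
  have hNc : Convex ℝ N := by
    rintro _ ⟨y, hy, rfl⟩ _ ⟨y', hy', rfl⟩ s t hs ht hst
    refine ⟨s • y + t • y', hKcv hy hy' hs ht hst, ?_⟩
    ext
    · simp [← add_mul, hst]
    · simp only [Prod.snd_add, Prod.smul_snd, smul_sub]
      rw [sub_add_sub_comm, ← add_smul, hst, one_smul]
  open scoped Pointwise in
  obtain ⟨f, hf⟩ := geometric_hahn_banach_point_open (x := (0 : (ι → ℝ) × Y))
    ((hPc.is_linear_image T.isBoundedLinearMap.toIsLinearMap).add hNc)
    ((T.isOpenMap hTsurj P hPo).add_right) (by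
      rintro ⟨_, ⟨⟨w, s⟩, hs, rfl⟩, _, ⟨y, hy, rfl⟩, h0⟩
      have h1 : ∀ i, L i w + s i + a i = 0 := fun i => congrFun (congrArg Prod.fst h0) i
      have h2 : A w + (b - y) = 0 := congrArg Prod.snd h0
      refine h w ?_ fun i => ?_
      · rwa [show A w + b = y by rw [← sub_eq_zero, ← h2]; abel]
      · have : 0 < s i := hs.2 i trivial
        linarith [h1 i])
  rw [map_zero] at hf
  let lam : ι → ℝ := fun i => f (Pi.single i 1, 0)
  let φ : Y →L[ℝ] ℝ := f.comp (ContinuousLinearMap.inr ℝ (ι → ℝ) Y)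
  have hfs : ∀ s y, f (s, y) = ∑ i, lam i * s i + φ y := by
    intro s y
    have h1 : (s, y) = (s, 0) + ((0 : ι → ℝ), y) := by simp
    have h2 : f (s, 0) = (f.comp (ContinuousLinearMap.inl ℝ (ι → ℝ) Y)) s := rfl
    rw [h1, map_add, h2, ← Finset.univ_sum_single s, map_sum]
    congr 1
    refine Finset.sum_congr rfl fun i _ => ?_
    have : Pi.single i (s i) = s i • (Pi.single i (1 : ℝ) : ι → ℝ) := by
      rw [← Pi.single_smul]; simp
    rw [this, map_smul, smul_eq_mul, mul_comm]
    simp [lam]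
  have hpos : ∀ (w : Z) (s : ι → ℝ) (y : Y), (∀ i, 0 < s i) → y ∈ K →
      0 < (∑ i, lam i * L i w + φ (A w)) + ∑ i, lam i * s i + (∑ i, lam i * a i + φ b) - φ y := by
    intro w s y hs hy
    have := hf _ (Set.add_mem_add (Set.mem_image_of_mem T (show (w, s) ∈ P from
      ⟨trivial, fun i _ => hs i⟩)) (Set.mem_image_of_mem _ hy))
    rw [map_add, hT, hfs, hfs, map_sub] at this
    simp only [mul_add, Finset.sum_add_distrib] at this
    linarith
  have hscale : ∀ p q : ℝ, (∀ r : ℝ, 0 < r → 0 < r * p + q) → 0 ≤ p := by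
    intro p q hpq
    by_contra! hp
    have h1 := hpq ((|q| + 1) / -p) (by have := neg_pos.2 hp; positivity)
    have h2 : (|q| + 1) / -p * p = -(|q| + 1) := by
      have := hp.ne
      field_simp
    linarith [le_abs_self q]
  have hlam : ∀ i, 0 ≤ lam i := by
    intro i
    refine hscale _ (∑ j, lam j + (∑ i, lam i * a i + φ b)) fun r hr => ?_
    have := hpos 0 (1 + Pi.single i r) 0 (fun j => by
      by_cases hj : j = i
      · subst hj; simp; positivity
      · simp [hj]) hK0
    simp [mul_add, Finset.sum_add_distrib, Pi.single_apply] at this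
    linarith
  have hφK : ∀ y ∈ K, φ y ≤ 0 := by
    intro y hy
    have := hscale (-φ y) (∑ i, lam i * 1 + (∑ i, lam i * a i + φ b)) fun r hr => by
      have := hpos 0 1 (r • y) (by simp) (hK y hy r hr)
      simp at this ⊢
      linarith
    linarith
  have hst0 : ∀ w, 0 ≤ ∑ i, lam i * L i w + φ (A w) := by
    intro w
    refine hscale _ (∑ i, lam i + (∑ i, lam i * a i + φ b)) fun r hr => ?_
    have := hpos (r • w) 1 0 (by simp) hK0
    simp only [map_smul, smul_eq_mul, map_zero, Pi.one_apply, mul_one, mul_left_comm _ r,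
      ← Finset.mul_sum] at this
    linarith
  have hst : ∀ w, ∑ i, lam i * L i w + φ (A w) = 0 := by
    intro w
    have := hst0 (-w)
    simp only [map_neg, mul_neg, Finset.sum_neg_distrib] at this
    linarith [hst0 w]
  have hval : 0 ≤ ∑ i, lam i * a i + φ b := by
    by_contra! hneg
    have hS : 0 ≤ ∑ i, lam i := Finset.sum_nonneg fun i _ => hlam i
    set v := ∑ i, lam i * a i + φ b
    have := hpos 0 (fun _ => -v / (∑ i, lam i + 1)) 0
      (fun i => div_pos (neg_pos.2 hneg) (by linarith)) hK0
    rw [hst, map_zero, ← Finset.sum_mul, mul_div_assoc', zero_add, sub_zero,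
      div_add' _ _ _ (by linarith), lt_div_iff₀ (by linarith)] at this
    nlinarith
  have hne : 0 < ∑ i, lam i ^ 2 := by
    refine (Finset.sum_nonneg fun i _ => sq_nonneg (lam i)).lt_of_ne fun h0 => ?_
    have hz : ∀ i, lam i = 0 := fun i => by
      have := (Finset.sum_eq_zero_iff_of_nonneg fun i _ => sq_nonneg (lam i)).1 h0.symm i
        (Finset.mem_univ i)
      simpa using this
    have hφ : ∀ y, φ y = 0 := fun y => by
      obtain ⟨w, rfl⟩ := hA y
      simpa [hz] using hst w
    have := hpos 0 1 0 (by simp) hK0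
    simp [hz, hφ] at this
  set c := (Real.sqrt (∑ i, lam i ^ 2))⁻¹ with hc
  have hcpos : 0 < c := by positivity
  refine ⟨fun i => c * lam i, c • φ, fun i => mul_nonneg hcpos.le (hlam i), ?_, fun y hy => ?_,
    fun w => ?_, ?_⟩
  · simp_rw [mul_pow, ← Finset.mul_sum]
    rw [hc, inv_pow, Real.sq_sqrt hne.le, inv_mul_cancel₀ hne.ne']
  · exact mul_nonpos_of_nonneg_of_nonpos hcpos.le (hφK y hy)
  · simp only [mul_assoc, ← Finset.mul_sum, smul_apply, smul_eq_mul]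
    rw [← mul_add, hst, mul_zero]
  · simp only [mul_assoc, ← Finset.mul_sum, smul_apply, smul_eq_mul]
    rw [← mul_add]
    exact mul_nonneg hcpos.le hval

/-- At a local weak Pareto point with surjective constraint derivative, no second-order
correction `w` of a critical direction `d` gives a common second-order decrease. -/
theorem not_forall_secondOrder_descent {ι Z E₀ E : Type*} [Finite ι]
    [NormedAddCommGroup Z] [NormedSpace ℝ Z] [CompleteSpace Z]
    [NormedAddCommGroup E₀] [NormedSpace ℝ E₀] [CompleteSpace E₀]
    [NormedAddCommGroup E] [NormedSpace ℝ E] [CompleteSpace E]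
    {I : ι → Z → ℝ} {F : Z → E₀} {G : Z → E} {Q : Set E} (hQ : Convex ℝ Q) {z : Z}
    (hI : ∀ i, ContDiffAt ℝ 2 (I i) z) (hF : ContDiffAt ℝ 2 F z) (hG : ContDiffAt ℝ 2 G z)
    (hF0 : F z = 0) (hGQ : G z ∈ Q)
    (hA : Function.Surjective ((fderiv ℝ F z).prod (fderiv ℝ G z)))
    (hmin : ∀ᶠ x in 𝓝 z, F x = 0 → G x ∈ Q → ¬ ∀ i, I i x - I i z < 0)
    {d w : Z} (hId : ∀ i, fderiv ℝ (I i) z d ≤ 0) (hFd : fderiv ℝ F z d = 0)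
    (hGd : fderiv ℝ G z d ∈ posCone ((fun q => q - G z) '' Q))
    (hFw : fderiv ℝ F z w + fderiv ℝ (fderiv ℝ F) z d d = 0)
    (hGw : fderiv ℝ G z w + fderiv ℝ (fderiv ℝ G) z d d ∈ posCone ((fun q => q - G z) '' Q)) :
    ¬ ∀ i, fderiv ℝ (I i) z w + fderiv ℝ (fderiv ℝ (I i)) z d d < 0 := by
  intro hIw
  obtain ⟨μ, hμ, _, ⟨q, hq, rfl⟩, hGd⟩ := hGd
  obtain ⟨ν, hν, _, ⟨q', hq', rfl⟩, hGw⟩ := hGw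
  have hpos : ∀ᶠ t : ℝ in 𝓝[>] 0, 0 < t := eventually_mem_nhdsWithin
  let p : ℝ → Z := fun t => z + t • d + (t ^ 2 / 2) • w
  let y : ℝ → E₀ × E := fun t => (0, G z + t • (μ • (q - G z)) + (t ^ 2 / 2) • (ν • (q' - G z)))
  let H : Z → E₀ × E := fun x => (F x, G x)
  have hp0 : (fun t => p t - (z + t • d + (t ^ 2 / 2) • w)) =o[𝓝[>] (0 : ℝ)] fun t => t ^ 2 := by
    simp [p]
  have hHy : (fun t => H (p t) - y t) =o[𝓝[>] (0 : ℝ)] fun t => t ^ 2 := by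
    have h1 := hF.isLittleO_along_curve hp0
    have h2 := hG.isLittleO_along_curve hp0
    simp only [hF0, hFd, hFw, hGd, hGw] at h1 h2
    refine (h1.prod_left h2).congr_left fun t => ?_
    simp [H, y, add_assoc]
  have hstrict : HasStrictFDerivAt H ((fderiv ℝ F z).prod (fderiv ℝ G z)) z :=
    (hF.hasStrictFDerivAt (by simp)).prodMk (hG.hasStrictFDerivAt (by simp))
  obtain ⟨C, hC⟩ := hstrict.exists_metric_regularity hA
  have hlim : Tendsto (fun t => (p t, y t)) (𝓝[>] (0 : ℝ)) (𝓝 (z, H z)) := by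
    have hcont : Continuous fun t => (p t, y t) := by fun_prop
    have h0 : (p 0, y 0) = (z, H z) := by simp [p, y, H, hF0]
    rw [← h0]
    exact hcont.continuousAt.mono_left nhdsWithin_le_nhds
  have hex := hlim.eventually hC
  choose! γ hγ using fun (t : ℝ) (ht : ∃ x, H x = y t ∧ ‖x - p t‖ ≤ C * ‖H (p t) - y t‖) => ht
  have hγo : (fun t => γ t - p t) =o[𝓝[>] (0 : ℝ)] fun t => t ^ 2 := by
    refine Asymptotics.IsBigO.trans_isLittleO (Asymptotics.IsBigO.of_bound C ?_) hHy
    filter_upwards [hex] with t ht using (hγ t ht).2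
  have hγz : Tendsto γ (𝓝[>] (0 : ℝ)) (𝓝 z) := by
    have h1 : Tendsto (fun t : ℝ => t ^ 2) (𝓝[>] 0) (𝓝 0) := by
      have : ContinuousAt (fun t : ℝ => t ^ 2) 0 := by fun_prop
      simpa [ContinuousAt] using this.mono_left (nhdsWithin_le_nhds (s := Set.Ioi 0))
    simpa using (hγo.trans_tendsto h1).add hlim.fst_nhds
  have hIdec : ∀ᶠ t in 𝓝[>] (0 : ℝ), ∀ i, I i (γ t) - I i z < 0 := by
    refine eventually_all.2 fun i => ?_
    have h1 := (hI i).isLittleO_along_curve hγo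
    have hc : 0 < -(fderiv ℝ (I i) z w + fderiv ℝ (fderiv ℝ (I i)) z d d) / 4 := by
      linarith [hIw i]
    filter_upwards [h1.def hc, hpos] with t ht htpos
    rw [Real.norm_eq_abs, Real.norm_eq_abs, abs_of_pos (by positivity : 0 < t ^ 2)] at ht
    have h2 := (abs_le.1 ht).2
    simp only [smul_eq_mul] at h2
    have h3 := mul_nonpos_of_nonneg_of_nonpos htpos.le (hId i)
    have h4 := mul_neg_of_pos_of_neg (by positivity : 0 < t ^ 2) (hIw i)
    linarith
  have hGfeas : ∀ᶠ t in 𝓝[>] (0 : ℝ), (y t).2 ∈ Q := by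
    have h1 : Tendsto (fun t : ℝ => t * μ + t ^ 2 / 2 * ν) (𝓝[>] 0) (𝓝 0) := by
      have : ContinuousAt (fun t : ℝ => t * μ + t ^ 2 / 2 * ν) 0 := by fun_prop
      simpa [ContinuousAt] using this.mono_left (nhdsWithin_le_nhds (s := Set.Ioi 0))
    filter_upwards [h1.eventually (gt_mem_nhds one_pos), hpos] with t ht htpos
    have := hQ.sum_mem (t := Finset.univ)
      (w := ![1 - (t * μ + t ^ 2 / 2 * ν), t * μ, t ^ 2 / 2 * ν]) (z := ![G z, q, q'])
      (by
        intro i _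
        fin_cases i
        · simpa using ht.le
        · simpa using by positivity
        · simpa using by positivity)
      (by simp only [Fin.sum_univ_three, Matrix.cons_val]; ring)
      (by
        intro i _
        fin_cases i
        · exact hGQ
        · exact hq
        · exact hq')
    convert this using 1
    simp only [y, Fin.sum_univ_three, Matrix.cons_val]
    module
  obtain ⟨t, ht, htI, htG, htz⟩ :=
    (hex.and (hIdec.and (hGfeas.and (hγz.eventually hmin)))).exists
  have hHγ := (hγ t ht).1
  refine htz (congrArg Prod.fst hHγ) ?_ htI
  rwa [← congrArg Prod.snd hHγ] at htG

/-- The cone generated by a convex set is convex. -/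
theorem Convex.posCone {E : Type*} [AddCommGroup E] [Module ℝ E] {A : Set E} (hA : Convex ℝ A) :
    Convex ℝ (posCone A) := by
  rintro _ ⟨μ, hμ, a, ha, rfl⟩ _ ⟨ν, hν, b, hb, rfl⟩ s t hs ht hst
  have hpos : 0 < s * μ + t * ν := by
    rcases hs.eq_or_lt with rfl | hs
    · rw [zero_add] at hst
      subst hst
      simpa using hν
    · positivity
  refine ⟨s * μ + t * ν, hpos, (s * μ / (s * μ + t * ν)) • a + (t * ν / (s * μ + t * ν)) • b,
    hA ha hb (by positivity) (by positivity) (by field_simp), ?_⟩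
  rw [smul_add, smul_smul, smul_smul, smul_smul, smul_smul, mul_div_cancel₀ _ hpos.ne',
    mul_div_cancel₀ _ hpos.ne']

/-- A direction tangent to a zero set is annihilated by the derivative. -/
theorem HasFDerivAt.eq_zero_of_mem_contCone {Z W : Type*} [NormedAddCommGroup Z] [NormedSpace ℝ Z]
    [NormedAddCommGroup W] [NormedSpace ℝ W] {F : Z → W} {F' : Z →L[ℝ] W} {z d : Z}
    (hF : HasFDerivAt F F' z) (hF0 : F z = 0) (hd : d ∈ contCone {x | F x = 0} z) : F' d = 0 := by
  obtain ⟨t, v, ht, ht0, hv, hmem⟩ := hd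
  have h1 : Tendsto (fun k => t k • v k) atTop (𝓝 0) := by simpa using ht0.smul hv
  have h2 := hF.hasFDerivWithinAt (s := {x | F x = 0}).lim (c := fun k => (t k)⁻¹) (v := d) h1
    (Eventually.of_forall hmem)
    (hv.congr fun k => by rw [smul_smul, inv_mul_cancel₀ (ht k).ne', one_smul])
  refine tendsto_nhds_unique h2 (tendsto_const_nhds.congr fun k => ?_)
  rw [show F (z + t k • v k) = 0 from hmem k, hF0, sub_zero, smul_zero]

/-- Multipliers converge along a converging sequence of critical directions. -/
theorem exists_multiplier_of_tendsto {ι Z Y : Type*} [Fintype ι]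
    [NormedAddCommGroup Z] [NormedSpace ℝ Z] [CompleteSpace Z]
    [NormedAddCommGroup Y] [NormedSpace ℝ Y] [CompleteSpace Y]
    (L : ι → Z →L[ℝ] ℝ) (A : Z →L[ℝ] Y) (hA : Function.Surjective A) (K : Set Y)
    {a : ℕ → ι → ℝ} {b : ℕ → Y} {a₀ : ι → ℝ} {b₀ : Y}
    (ha : Tendsto a atTop (𝓝 a₀)) (hb : Tendsto b atTop (𝓝 b₀))
    (h : ∀ k, ∃ (lam : ι → ℝ) (φ : Y →L[ℝ] ℝ), (∀ i, 0 ≤ lam i) ∧ (∑ i, lam i ^ 2 = 1) ∧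
      (∀ y ∈ K, φ y ≤ 0) ∧ (∀ w, ∑ i, lam i * L i w + φ (A w) = 0) ∧
      0 ≤ ∑ i, lam i * a k i + φ (b k)) :
    ∃ (lam : ι → ℝ) (φ : Y →L[ℝ] ℝ), (∀ i, 0 ≤ lam i) ∧ (∑ i, lam i ^ 2 = 1) ∧
      (∀ y ∈ K, φ y ≤ 0) ∧ (∀ w, ∑ i, lam i * L i w + φ (A w) = 0) ∧
      0 ≤ ∑ i, lam i * a₀ i + φ b₀ := by
  choose lam φ hlam hnorm hK hst hval using h
  have hbox : ∀ k, lam k ∈ Set.Icc (0 : ι → ℝ) 1 := fun k => ⟨hlam k, fun i => by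
    have h1 := Finset.single_le_sum (f := fun i => lam k i ^ 2) (fun i _ => sq_nonneg _)
      (Finset.mem_univ i)
    rw [hnorm k] at h1
    exact (sq_le_one_iff₀ (hlam k i)).1 h1⟩
  obtain ⟨l, hl, σ, hσ, hlim⟩ := isCompact_Icc.tendsto_subseq hbox
  have hli : ∀ i, Tendsto (fun k => lam (σ k) i) atTop (𝓝 (l i)) := tendsto_pi_nhds.1 hlim
  have hemb := isClosedEmbedding_precomp_of_surjective A hA
  have hcomp : ∀ k, (φ (σ k)).comp A = -∑ i, lam (σ k) i • L i := fun k => by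
    ext w
    have := hst (σ k) w
    simp only [ContinuousLinearMap.comp_apply, neg_apply, sum_apply, smul_apply, smul_eq_mul]
    linarith
  have hcl : Tendsto (fun k => (φ (σ k)).comp A) atTop (𝓝 (-∑ i, l i • L i)) := by
    simp_rw [hcomp]
    exact (tendsto_finsetSum _ fun i _ => (hli i).smul_const (L i)).neg
  obtain ⟨ψ, hψ⟩ := hemb.isClosed_range.mem_of_tendsto hcl
    (Eventually.of_forall fun k => Set.mem_range_self (φ (σ k)))
  rw [← hψ] at hcl
  have hφ : Tendsto (fun k => φ (σ k)) atTop (𝓝 ψ) := hemb.tendsto_nhds_iff.2 hcl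
  have hev : ∀ {y : ℕ → Y} {y₀ : Y}, Tendsto y atTop (𝓝 y₀) →
      Tendsto (fun k => φ (σ k) (y k)) atTop (𝓝 (ψ y₀)) := fun hy =>
    (isBoundedBilinearMap_apply.continuous.tendsto (ψ, _)).comp (hφ.prodMk_nhds hy)
  refine ⟨l, ψ, hl.1, ?_, fun y hy => ?_, fun w => ?_, ?_⟩
  · refine tendsto_nhds_unique (tendsto_finsetSum _ fun i _ => (hli i).pow 2) ?_
    simp [hnorm]
  · exact le_of_tendsto (hev tendsto_const_nhds)
      (Eventually.of_forall fun k => hK (σ k) y hy)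
  · have := congrArg (fun f => f w) hψ
    simp only [ContinuousLinearMap.comp_apply, neg_apply, sum_apply, smul_apply,
      smul_eq_mul] at this
    linarith
  · refine ge_of_tendsto ((tendsto_finsetSum _ fun i _ =>
      (hli i).mul ((tendsto_pi_nhds.1 ha i).comp hσ.tendsto_atTop)).add
      (hev (hb.comp hσ.tendsto_atTop))) (Eventually.of_forall fun k => hval (σ k))

/-- Second-order necessary optimality conditions for the abstract multi-objective
optimal control problem (MP2) under assumptions (A1)–(A3). -/
theorem secondOrder_necessary_condition_MP2
    {X U E₀ E : Type*}
    [NormedAddCommGroup X] [NormedSpace ℝ X] [CompleteSpace X]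
    [NormedAddCommGroup U] [NormedSpace ℝ U] [CompleteSpace U]
    [NormedAddCommGroup E₀] [NormedSpace ℝ E₀] [CompleteSpace E₀]
    [NormedAddCommGroup E] [NormedSpace ℝ E] [CompleteSpace E]
    {m : ℕ} (I : Fin m → X × U → ℝ) (F : X × U → E₀) (G : X × U → E)
    (Q : Set E) (hQne : Q.Nonempty) (hQcl : IsClosed Q) (hQcv : Convex ℝ Q)
    (x₀ : X) (u₀ : U)
    -- feasibility
    (hF0 : F (x₀, u₀) = 0) (hGQ : G (x₀, u₀) ∈ Q)
    -- (A1): twice continuous differentiability on a product of balls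
    (hA1 : ∃ r₁ > (0:ℝ), ∃ r₁' > (0:ℝ),
      (∀ i, ContDiffOn ℝ 2 (I i) (Metric.closedBall x₀ r₁ ×ˢ Metric.closedBall u₀ r₁')) ∧
      ContDiffOn ℝ 2 F (Metric.closedBall x₀ r₁ ×ˢ Metric.closedBall u₀ r₁') ∧
      ContDiffOn ℝ 2 G (Metric.closedBall x₀ r₁ ×ˢ Metric.closedBall u₀ r₁'))
    -- (A2): `F_x(z₀)` is bijective
    (hA2 : Function.Bijective (fun x : X => fderiv ℝ F (x₀, u₀) (x, 0)))
    -- (A3): `∇G(z₀)(T(D; z₀)) = E`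
    (hA3 : (fun d => fderiv ℝ G (x₀, u₀) d) ''
      contCone {z : X × U | F z = 0} (x₀, u₀) = Set.univ)
    -- locally weak Pareto solution of (MP2)
    (hPareto : ∃ ε > 0, ∀ z : X × U, F z = 0 → G z ∈ Q → ‖z - (x₀, u₀)‖ ≤ ε →
      ¬ (∀ i, I i z - I i (x₀, u₀) < 0)) :
    ∀ d ∈ closure {d : X × U |
        (∀ i, fderiv ℝ (I i) (x₀, u₀) d ≤ 0) ∧
        fderiv ℝ F (x₀, u₀) d = 0 ∧
        fderiv ℝ G (x₀, u₀) d ∈ posCone ((fun q => q - G (x₀, u₀)) '' Q)},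
      ∃ (lam : Fin m → ℝ) (vstar : E₀ →L[ℝ] ℝ) (estar : E →L[ℝ] ℝ),
        (∀ i, 0 ≤ lam i) ∧ (∑ i, lam i ^ 2 = 1) ∧
        (∀ q ∈ Q, estar (q - G (x₀, u₀)) ≤ 0) ∧
        (∀ z : X × U, (∑ i, lam i * fderiv ℝ (I i) (x₀, u₀) z) +
          vstar (fderiv ℝ F (x₀, u₀) z) + estar (fderiv ℝ G (x₀, u₀) z) = 0) ∧
        0 ≤ (∑ i, lam i * fderiv ℝ (fderiv ℝ (I i)) (x₀, u₀) d d) +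
            vstar (fderiv ℝ (fderiv ℝ F) (x₀, u₀) d d) +
            estar (fderiv ℝ (fderiv ℝ G) (x₀, u₀) d d) := by
  obtain ⟨r, hr, r', hr', hI, hF, hG⟩ := hA1
  obtain ⟨ε, hε, hmin⟩ := hPareto
  have hnhds : Metric.closedBall x₀ r ×ˢ Metric.closedBall u₀ r' ∈ 𝓝 (x₀, u₀) :=
    prod_mem_nhds (Metric.closedBall_mem_nhds x₀ hr) (Metric.closedBall_mem_nhds u₀ hr')
  replace hI := fun i => (hI i).contDiffAt hnhds
  replace hF := hF.contDiffAt hnhds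
  replace hG := hG.contDiffAt hnhds
  set z₀ : X × U := (x₀, u₀)
  set K : Set (E₀ × E) := {0} ×ˢ posCone ((fun q => q - G z₀) '' Q)
  have hsubQ : Convex ℝ ((fun q => q - G z₀) '' Q) := by
    simpa only [sub_eq_neg_add] using hQcv.translate (-G z₀)
  have hKcv : Convex ℝ K := (convex_singleton 0).prod hsubQ.posCone
  have hK0 : (0 : E₀ × E) ∈ K := ⟨rfl, 1, one_pos, 0, ⟨G z₀, hGQ, sub_self _⟩, by simp⟩
  have hKs : ∀ y ∈ K, ∀ s : ℝ, 0 < s → s • y ∈ K := by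
    rintro ⟨e₀, e⟩ ⟨h0, μ, hμ, c, hc, he⟩ s hs
    refine ⟨?_, s * μ, mul_pos hs hμ, c, hc, ?_⟩
    · rw [Set.mem_singleton_iff] at h0 ⊢
      simp_all
    · simp_all [smul_smul]
  set A := (fderiv ℝ F z₀).prod (fderiv ℝ G z₀) with hAdef
  have hA : Function.Surjective A := by
    rintro ⟨e₀, e⟩
    obtain ⟨x, hx⟩ := hA2.2 e₀
    obtain ⟨d, hd, hGd⟩ := hA3.ge (Set.mem_univ (e - fderiv ℝ G z₀ (x, 0)))
    have hFd := (hF.differentiableAt (by simp)).hasFDerivAt.eq_zero_of_mem_contCone hF0 hd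
    refine ⟨(x, 0) + d, Prod.ext ?_ ?_⟩
    · simpa [A, hFd] using hx
    · simp only at hGd
      simp [A, hGd]
  have hmin' : ∀ᶠ x in 𝓝 z₀, F x = 0 → G x ∈ Q → ¬ ∀ i, I i x - I i z₀ < 0 := by
    filter_upwards [Metric.closedBall_mem_nhds z₀ hε] with x hx hFx hGx
    exact hmin x hFx hGx (by simpa [dist_eq_norm] using hx)
  intro d hd
  obtain ⟨D, hD, hDd⟩ := mem_closure_iff_seq_limit.1 hd
  obtain ⟨lam, φ, hlam, hnorm, hφK, hst, hval⟩ :=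
    exists_multiplier_of_tendsto (fun i => fderiv ℝ (I i) z₀) A hA K
      (tendsto_pi_nhds.2 fun i => (fderiv ℝ (fderiv ℝ (I i)) z₀).tendsto_apply_apply_self hDd)
      (((fderiv ℝ (fderiv ℝ F) z₀).tendsto_apply_apply_self hDd).prodMk_nhds
        ((fderiv ℝ (fderiv ℝ G) z₀).tendsto_apply_apply_self hDd))
      fun k => exists_multiplier_of_linear_alternative _ _ A hA _ K hKcv hK0 hKs
        fun w hw => not_forall_secondOrder_descent hQcv hI hF hG hF0 hGQ hA hmin'
          (hD k).1 (hD k).2.1 (hD k).2.2 hw.1 hw.2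
  have hsplit : ∀ e₀ e, φ (e₀, e) = φ (e₀, 0) + φ (0, e) := fun e₀ e => by
    rw [← map_add, Prod.mk_add_mk, add_zero, zero_add]
  refine ⟨lam, φ.comp (ContinuousLinearMap.inl ℝ E₀ E), φ.comp (ContinuousLinearMap.inr ℝ E₀ E),
    hlam, hnorm, fun q hq => hφK _ ⟨rfl, 1, one_pos, _, ⟨q, hq, rfl⟩, by simp⟩, fun w => ?_, ?_⟩
  · rw [add_assoc]
    exact (congrArg _ (hsplit _ _).symm).trans (hst w)
  · rw [add_assoc]
    exact hval.trans_eq (congrArg _ (hsplit _ _))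
end

section
/- Let z₀ = (x₀, u₀) be a feasible point of (MP2) satisfying assumptions (A1)–(A3), let ζ be the C² implicit function defined on a ball B_U(u₀, r₂′) with ζ(u₀) = x₀ and F(ζ(u), u) = 0, and set H(u) = G(ζ(u), u). Then E = ∇H(u₀)(U) − cone(Q − H(u₀)); in particular, the Robinson constraint qualification for the reduced problem of minimizing J(u) = I(ζ(u), u) subject to H(u) ∈ Q holds at u₀. -/
open Filter Topology

/-- The derivative of a function vanishing on `Ω` annihilates the contingent cone to `Ω`. -/
theorem HasFDerivAt.apply_eq_zero_of_mem_contCone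
    {Z W : Type*} [NormedAddCommGroup Z] [NormedSpace ℝ Z]
    [NormedAddCommGroup W] [NormedSpace ℝ W] {f : Z → W} {f' : Z →L[ℝ] W} {Ω : Set Z} {z d : Z}
    (hf : HasFDerivAt f f' z) (hz : f z = 0) (hΩ : ∀ y ∈ Ω, f y = 0) (hd : d ∈ contCone Ω z) :
    f' d = 0 := by
  obtain ⟨t, v, htpos, ht, hv, hmem⟩ := hd
  have hdisp : Tendsto (fun k => t k • v k) atTop (𝓝 0) := by
    simpa using ht.smul hv
  have hscaled : Tendsto (fun k => (t k)⁻¹ • (t k • v k)) atTop (𝓝 d) :=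
    hv.congr fun k => (inv_smul_smul₀ (htpos k).ne' (v k)).symm
  have hlim := (hf.hasFDerivWithinAt (s := Ω)).lim hdisp (Eventually.of_forall hmem) hscaled
  refine tendsto_nhds_unique hlim (tendsto_const_nhds.congr fun k => ?_)
  simp [hΩ _ (hmem k), hz]

/-- Under (A1)–(A3), the reduced constraint map `H(u) = G(ζ(u), u)` satisfies
`E = ∇H(u₀)(U) − cone(Q − H(u₀))`, i.e. the Robinson constraint qualification for
the reduced problem (MP3) holds at `u₀`. -/
theorem robinsonCQ_reduced_problem
    {X U E₀ E : Type*}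
    [NormedAddCommGroup X] [NormedSpace ℝ X] [CompleteSpace X]
    [NormedAddCommGroup U] [NormedSpace ℝ U] [CompleteSpace U]
    [NormedAddCommGroup E₀] [NormedSpace ℝ E₀] [CompleteSpace E₀]
    [NormedAddCommGroup E] [NormedSpace ℝ E] [CompleteSpace E]
    {m : ℕ} (I : Fin m → X × U → ℝ) (F : X × U → E₀) (G : X × U → E)
    (Q : Set E) (hQne : Q.Nonempty) (hQcl : IsClosed Q) (hQcv : Convex ℝ Q)
    (x₀ : X) (u₀ : U)
    (hF0 : F (x₀, u₀) = 0) (hGQ : G (x₀, u₀) ∈ Q)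
    (hA1 : ∃ r₁ > (0:ℝ), ∃ r₁' > (0:ℝ),
      (∀ i, ContDiffOn ℝ 2 (I i) (Metric.closedBall x₀ r₁ ×ˢ Metric.closedBall u₀ r₁')) ∧
      ContDiffOn ℝ 2 F (Metric.closedBall x₀ r₁ ×ˢ Metric.closedBall u₀ r₁') ∧
      ContDiffOn ℝ 2 G (Metric.closedBall x₀ r₁ ×ˢ Metric.closedBall u₀ r₁'))
    (hA2 : Function.Bijective (fun x : X => fderiv ℝ F (x₀, u₀) (x, 0)))
    (hA3 : (fun d => fderiv ℝ G (x₀, u₀) d) ''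
      contCone {z : X × U | F z = 0} (x₀, u₀) = Set.univ)
    -- the implicit function ζ
    (r₂ r₂' : ℝ) (hr₂ : 0 < r₂) (hr₂' : 0 < r₂') (ζ : U → X)
    (hζmap : ∀ u ∈ Metric.closedBall u₀ r₂', ζ u ∈ Metric.closedBall x₀ r₂)
    (hζC2 : ContDiffOn ℝ 2 ζ (Metric.closedBall u₀ r₂'))
    (hζ0 : ζ u₀ = x₀)
    (hζF : ∀ u ∈ Metric.closedBall u₀ r₂', F (ζ u, u) = 0) :
    ∀ e : E, ∃ (u : U) (v : E),
      v ∈ posCone ((fun q => q - G (ζ u₀, u₀)) '' Q) ∧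
      e = fderiv ℝ (fun u => G (ζ u, u)) u₀ u - v := by
  subst hζ0
  intro e
  obtain ⟨r₁, hr₁, r₁', hr₁', -, hF, hG⟩ := hA1
  have hnhds : Metric.closedBall (ζ u₀) r₁ ×ˢ Metric.closedBall u₀ r₁' ∈ 𝓝 (ζ u₀, u₀) :=
    prod_mem_nhds (Metric.closedBall_mem_nhds (ζ u₀) hr₁) (Metric.closedBall_mem_nhds u₀ hr₁')
  have hF' : HasFDerivAt F (fderiv ℝ F (ζ u₀, u₀)) (ζ u₀, u₀) :=
    ((hF.contDiffAt hnhds).differentiableAt two_ne_zero).hasFDerivAt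
  have hG' : HasFDerivAt G (fderiv ℝ G (ζ u₀, u₀)) (ζ u₀, u₀) :=
    ((hG.contDiffAt hnhds).differentiableAt two_ne_zero).hasFDerivAt
  have hball := Metric.closedBall_mem_nhds u₀ hr₂'
  have hζ' : HasFDerivAt ζ (fderiv ℝ ζ u₀) u₀ :=
    ((hζC2.contDiffAt hball).differentiableAt two_ne_zero).hasFDerivAt
  have hgraph := hζ'.prodMk (hasFDerivAt_id u₀)
  have hFζ := hF'.comp (f := fun u => (ζ u, u)) u₀ hgraph
  have hGζ := hG'.comp (f := fun u => (ζ u, u)) u₀ hgraph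
  have hFζ_zero := hFζ.unique ((hasFDerivAt_const (0 : E₀) u₀).congr_of_eventuallyEq
    (eventually_of_mem hball hζF))
  obtain ⟨⟨h, u⟩, hd, rfl⟩ := hA3.symm ▸ Set.mem_univ e
  have hker := hF'.apply_eq_zero_of_mem_contCone hF0 (fun _ hy => hy) hd
  have hker_graph : fderiv ℝ F (ζ u₀, u₀) (fderiv ℝ ζ u₀ u, u) = 0 :=
    DFunLike.congr_fun hFζ_zero u
  have h_eq : h = fderiv ℝ ζ u₀ u := by
    have hsplit (a : X) : fderiv ℝ F (ζ u₀, u₀) (a, u) =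
        fderiv ℝ F (ζ u₀, u₀) (a, 0) + fderiv ℝ F (ζ u₀, u₀) (0, u) := by
      rw [← map_add]; simp
    exact hA2.injective (add_right_cancel
      ((hsplit _).symm.trans (hker.trans (hker_graph.symm.trans (hsplit _)))))
  refine ⟨u, 0, ⟨1, one_pos, 0, ⟨G (ζ u₀, u₀), hGQ, by simp⟩, by simp⟩, ?_⟩
  have hderiv : fderiv ℝ (fun u => G (ζ u, u)) u₀ u =
      fderiv ℝ G (ζ u₀, u₀) (fderiv ℝ ζ u₀ u, u) := DFunLike.congr_fun hGζ.fderiv u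
  rw [hderiv, h_eq, sub_zero]
end

section
/- Let z₀ = (x₀, u₀) be a feasible point of (MP2) satisfying assumptions (A1) and (A2), let ζ be the C² implicit function with ζ(u₀) = x₀ and F(ζ(u), u) = 0 near u₀, and define J(u) = I(ζ(u), u) and H(u) = G(ζ(u), u). Then (x₀, u₀) is a locally weak Pareto solution of (MP2) if and only if u₀ is a locally weak Pareto solution of the reduced problem (MP3) of minimizing J(u) with respect to ℝ^m₊ subject to H(u) ∈ Q. -/
open Filter Topology

/-- Under (A1), (A2) and the implicit function `ζ` (with its uniqueness property),
`(x₀, u₀)` is a locally weak Pareto solution of (MP2) if and only if `u₀` is a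
locally weak Pareto solution of the reduced problem (MP3): minimize `J(u) = I(ζ(u), u)`
subject to `H(u) = G(ζ(u), u) ∈ Q`. -/
theorem weakPareto_MP2_iff_weakPareto_MP3
    {X U E₀ E : Type*}
    [NormedAddCommGroup X] [NormedSpace ℝ X] [CompleteSpace X]
    [NormedAddCommGroup U] [NormedSpace ℝ U] [CompleteSpace U]
    [NormedAddCommGroup E₀] [NormedSpace ℝ E₀] [CompleteSpace E₀]
    [NormedAddCommGroup E] [NormedSpace ℝ E] [CompleteSpace E]
    {m : ℕ} (I : Fin m → X × U → ℝ) (F : X × U → E₀) (G : X × U → E)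
    (Q : Set E) (hQne : Q.Nonempty) (hQcl : IsClosed Q) (hQcv : Convex ℝ Q)
    (x₀ : X) (u₀ : U)
    (hF0 : F (x₀, u₀) = 0) (hGQ : G (x₀, u₀) ∈ Q)
    (r₁ r₁' : ℝ) (hr₁ : 0 < r₁) (hr₁' : 0 < r₁')
    -- (A1)
    (hI : ∀ i, ContDiffOn ℝ 2 (I i) (Metric.closedBall x₀ r₁ ×ˢ Metric.closedBall u₀ r₁'))
    (hF : ContDiffOn ℝ 2 F (Metric.closedBall x₀ r₁ ×ˢ Metric.closedBall u₀ r₁'))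
    (hG : ContDiffOn ℝ 2 G (Metric.closedBall x₀ r₁ ×ˢ Metric.closedBall u₀ r₁'))
    -- (A2)
    (hA2 : Function.Bijective (fun x : X => fderiv ℝ F (x₀, u₀) (x, 0)))
    -- the implicit function ζ on B_U(u₀, r₂′) with values in B_X(x₀, r₂)
    (r₂ r₂' : ℝ) (hr₂ : 0 < r₂) (hr₂' : 0 < r₂') (hr₂₁ : r₂ ≤ r₁) (hr₂₁' : r₂' ≤ r₁')
    (ζ : U → X)
    (hζmap : ∀ u ∈ Metric.closedBall u₀ r₂', ζ u ∈ Metric.closedBall x₀ r₂)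
    (hζC2 : ContDiffOn ℝ 2 ζ (Metric.closedBall u₀ r₂'))
    (hζ0 : ζ u₀ = x₀)
    (hζF : ∀ u ∈ Metric.closedBall u₀ r₂', F (ζ u, u) = 0)
    -- uniqueness of the implicit solution in `B_X(x₀, r₂)`
    (hζuniq : ∀ u ∈ Metric.closedBall u₀ r₂', ∀ x ∈ Metric.closedBall x₀ r₂,
      F (x, u) = 0 → x = ζ u) :
    -- (MP2) local weak Pareto at (x₀, u₀)  ↔  (MP3) local weak Pareto at u₀
    ((∃ ε > 0, ∀ z : X × U, F z = 0 → G z ∈ Q → ‖z - (x₀, u₀)‖ ≤ ε →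
        ¬ (∀ i, I i z - I i (x₀, u₀) < 0)) ↔
      (∃ ε > 0, ∀ u ∈ Metric.closedBall u₀ r₂', G (ζ u, u) ∈ Q → ‖u - u₀‖ ≤ ε →
        ¬ (∀ i, I i (ζ u, u) - I i (x₀, u₀) < 0))) := by
  constructor
  · rintro ⟨ε, hε, h⟩
    have hu₀ : u₀ ∈ Metric.closedBall u₀ r₂' := Metric.mem_closedBall_self hr₂'.le
    obtain ⟨δ, hδ, hζδ⟩ := Metric.continuousWithinAt_iff.1 (hζC2.continuousOn u₀ hu₀) ε hε
    refine ⟨min (δ / 2) ε, lt_min (half_pos hδ) hε, fun u hu hGu huε => ?_⟩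
    refine h (ζ u, u) (hζF u hu) hGu ?_
    have hζu : ‖ζ u - x₀‖ < ε := by
      have hdist : dist u u₀ < δ := by
        rw [dist_eq_norm]
        exact (huε.trans (min_le_left _ _)).trans_lt (half_lt_self hδ)
      simpa only [hζ0, dist_eq_norm] using hζδ hu hdist
    exact max_le hζu.le (huε.trans (min_le_right _ _))
  · rintro ⟨ε, hε, h⟩
    refine ⟨min ε (min r₂ r₂'), lt_min hε (lt_min hr₂ hr₂'), ?_⟩
    rintro ⟨x, u⟩ hFz hGz hz
    obtain ⟨hzε, hzr⟩ := le_min_iff.1 hz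
    obtain ⟨hzr₂, hzr₂'⟩ := le_min_iff.1 hzr
    have hx : x ∈ Metric.closedBall x₀ r₂ :=
      mem_closedBall_iff_norm.2 ((norm_fst_le ((x, u) - (x₀, u₀))).trans hzr₂)
    have hu : u ∈ Metric.closedBall u₀ r₂' :=
      mem_closedBall_iff_norm.2 ((norm_snd_le ((x, u) - (x₀, u₀))).trans hzr₂')
    obtain rfl := hζuniq u hu x hx hFz
    exact h u hu hGz ((norm_snd_le ((ζ u, u) - (x₀, u₀))).trans hzε)
end
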